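/- arXiv:2401.08306 — 4 statements merged into one kernel-verified Lean document; each statement's English description precedes it below -/
import Mathlib

section
/- Let F be a discretely valued Henselian field with perfect residue field, E/F a finitely ramified separable algebraic extension, and r ∈ [−1,∞). Choose any finitely ramified Galois extension M/F inside F^sep containing a normal closure of E. Then the action of Gal(M/F) on Hom_{F-alg}(E, F^sep) by post-composition induces a well-defined transitive action on the set of Ξ_r-equivalence classes; consequently all Ξ_r-equivalence classes have the same cardinality. -/
noncomputable section

open scoped Classical

/-- An additive `ℝ ∪ {⊤}`-valued valuation on a field `Ω`. -/
structure AddVal (Ω : Type*) [Field Ω] where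
  v : Ω → WithTop ℝ
  v_zero : v 0 = ⊤
  v_ne_top : ∀ x : Ω, x ≠ 0 → v x ≠ ⊤
  v_mul : ∀ x y : Ω, v (x * y) = v x + v y
  v_min_le_add : ∀ x y : Ω, min (v x) (v y) ≤ v (x + y)

namespace AddVal

variable {Ω : Type*} [Field Ω]

/-- `V` is normalized on `F`: its value group on `F^×` is exactly `ℤ`.
This encodes that `F` is a discretely valued field and `V` extends the
normalized discrete valuation `val_F` of `F`. -/
def IsNormalizedOn (V : AddVal Ω) (F : Type*) [Field F] [Algebra F Ω] : Prop :=
  (∀ x : F, x ≠ 0 → ∃ k : ℤ, V.v (algebraMap F Ω x) = ((k : ℝ) : WithTop ℝ)) ∧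
    (∃ x : F, V.v (algebraMap F Ω x) = ((1 : ℝ) : WithTop ℝ))

/-- Henselian property of the valued field `(F, val_F)` (simple-root Hensel lemma). -/
def IsHenselianOn (V : AddVal Ω) (F : Type*) [Field F] [Algebra F Ω] : Prop :=
  ∀ f : Polynomial F,
    (∀ i : ℕ, 0 ≤ V.v (algebraMap F Ω (f.coeff i))) →
      ∀ a₀ : F, 0 ≤ V.v (algebraMap F Ω a₀) →
        0 < V.v (algebraMap F Ω (Polynomial.eval a₀ f)) →
        V.v (algebraMap F Ω (Polynomial.eval a₀ (Polynomial.derivative f))) = 0 →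
        ∃ a : F, Polynomial.eval a f = 0 ∧ 0 < V.v (algebraMap F Ω (a - a₀))

/-- The residue field of `(F, val_F)` is perfect: in positive residue characteristic `p`,
the Frobenius is surjective on the residue field. -/
def HasPerfectResidueFieldOn (V : AddVal Ω) (F : Type*) [Field F] [Algebra F Ω] : Prop :=
  ∀ p : ℕ, p.Prime → 0 < V.v (algebraMap F Ω (p : F)) →
    ∀ x : F, 0 ≤ V.v (algebraMap F Ω x) →
      ∃ y : F, 0 ≤ V.v (algebraMap F Ω y) ∧ 0 < V.v (algebraMap F Ω (x - y ^ p))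

/-- `e` is the (absolute) ramification index of `E` over the field on which `V` is
normalized: the value group of `E^×` is exactly `(1/e)ℤ`.  In particular `E` is
finitely ramified. -/
def IsRamIdx (V : AddVal Ω) {K : Type*} [Field K] [Algebra K Ω]
    (E : IntermediateField K Ω) (e : ℕ) : Prop :=
  0 < e ∧
    (∀ x : ↥E, x ≠ 0 → ∃ k : ℤ, V.v (x : Ω) = ((((k : ℝ) / (e : ℝ) : ℝ)) : WithTop ℝ)) ∧
    (∃ x : ↥E, V.v (x : Ω) = (((1 / (e : ℝ) : ℝ)) : WithTop ℝ))

end AddVal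

/-- The lower ramification relation `Ξ_r` on `K`-algebra embeddings of `E` into `Ω`,
where `e` is the absolute ramification index of `E` (over the normalization field of `V`):
`σ Ξ_r τ` iff `val_M (σ x - τ x) ≥ e(M/E) (r+1)` for all integral `x` and any (equivalently
some) suitable Galois `M`; this is equivalent to `V.v (σ x - τ x) ≥ (r+1)/e` for all
integral `x`. -/
def xiRel {Ω : Type*} [Field Ω] (V : AddVal Ω) {K : Type*} [Field K] [Algebra K Ω]
    (E : IntermediateField K Ω) (e : ℕ) (r : ℝ) (σ τ : ↥E →ₐ[K] Ω) : Prop :=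
  ∀ x : ↥E, 0 ≤ V.v (x : Ω) →
    ((((r + 1) / (e : ℝ) : ℝ)) : WithTop ℝ) ≤ V.v (σ x - τ x)

/-- `g_t`: the (common) cardinality of a `Ξ_t`-equivalence class, realized as the
cardinality of the class of the inclusion `E ↪ Ω`. -/
def gfun {Ω : Type*} [Field Ω] (V : AddVal Ω) {K : Type*} [Field K] [Algebra K Ω]
    (E : IntermediateField K Ω) (e : ℕ) (t : ℝ) : ℕ :=
  Nat.card {σ : ↥E →ₐ[K] Ω // xiRel V E e t σ E.val}

/-- The Herbrand function `φ_{E/K}(r) = ∫_0^r (g_t / g_0) dt`. -/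
def herbrand {Ω : Type*} [Field Ω] (V : AddVal Ω) {K : Type*} [Field K] [Algebra K Ω]
    (E : IntermediateField K Ω) (e : ℕ) (r : ℝ) : ℝ :=
  ∫ t in (0:ℝ)..r, ((gfun V E e t : ℝ) / (gfun V E e 0 : ℝ))

/-- `E/K` is at most `l`-ramified: for every finite subextension `E₀/K` the relation
`Ξ^l = Ξ_{ψ_{E₀/K}(l)}` is trivial. -/
def atMostRamified {Ω : Type*} [Field Ω] (V : AddVal Ω) {K : Type*} [Field K] [Algebra K Ω]
    (E : IntermediateField K Ω) (l : ℝ) : Prop :=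
  ∀ E₀ : IntermediateField K Ω, E₀ ≤ E → FiniteDimensional K ↥E₀ →
    ∀ (e₀ : ℕ) (s : ℝ), V.IsRamIdx E₀ e₀ → 0 ≤ s → herbrand V E₀ e₀ s = l →
      ∀ σ τ : ↥E₀ →ₐ[K] Ω, xiRel V E₀ e₀ s σ τ → σ = τ

/-- Membership of `γ ∈ Γ_K` in the upper ramification subgroup `I_K^l`: for every
finite Galois subextension `M/K` (with ramification index `eM` and `ψ_{M/K}(l) = sM`),
the image of `γ` in `Gal(M/K)` lies in `Gal(M/K)^l = Gal(M/K)_{ψ_{M/K}(l)}`. -/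
def inUpperRam {Ω : Type*} [Field Ω] (V : AddVal Ω) {K : Type*} [Field K] [Algebra K Ω]
    (l : ℝ) (γ : Ω ≃ₐ[K] Ω) : Prop :=
  ∀ (M : IntermediateField K Ω) (eM : ℕ) (sM : ℝ),
    FiniteDimensional K ↥M → IsGalois K ↥M → V.IsRamIdx M eM → 0 ≤ sM →
      herbrand V M eM sM = l →
      xiRel V M eM sM (γ.toAlgHom.comp M.val) M.val

open Polynomial in
theorem AddValuation.coeff_prod_X_sub_C_nonneg {Ω : Type*} [Field Ω]
    (v : AddValuation Ω (WithTop ℝ)) (Z : Finset Ω) (hZ : ∀ z ∈ Z, 0 ≤ v z) (i : ℕ) :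
    0 ≤ v ((∏ z ∈ Z, (X - C z)).coeff i) := by
  refine Finset.prod_induction (fun z : Ω => (X - C z : Polynomial Ω))
    (fun p : Polynomial Ω => ∀ i, 0 ≤ v (p.coeff i)) ?_ ?_ ?_ i
  · intro p q hp hq i
    rw [coeff_mul]
    refine v.map_le_sum fun c _ => ?_
    rw [v.map_mul]
    exact add_nonneg (hp _) (hq _)
  · intro i
    rw [coeff_one]
    split_ifs <;> simp
  · intro z hz i
    rw [coeff_sub, coeff_X, coeff_C]
    refine v.map_le_sub ?_ ?_
    · split_ifs <;> simp
    · split_ifs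
      · exact hZ z hz
      · simp

open Polynomial in
theorem AddValuation.eval_one_nonneg {Ω : Type*} [Field Ω]
    (v : AddValuation Ω (WithTop ℝ)) (p : Polynomial Ω) (hp : ∀ i, 0 ≤ v (p.coeff i)) :
    0 ≤ v (p.eval 1) := by
  rw [eval_eq_sum, Polynomial.sum]
  refine v.map_le_sum fun i _ => ?_
  simpa using hp i

theorem AddValuation.natCast_nonneg {Ω : Type*} [Field Ω]
    (v : AddValuation Ω (WithTop ℝ)) (n : ℕ) : 0 ≤ v (n : Ω) := by
  induction n with
  | zero => simp
  | succ n ih =>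
    push_cast
    exact v.map_le_add ih (by simp)

theorem AddValuation.map_prod {Ω ι : Type*} [Field Ω]
    (v : AddValuation Ω (WithTop ℝ)) (s : Finset ι) (f : ι → Ω) :
    v (∏ i ∈ s, f i) = ∑ i ∈ s, v (f i) := by
  induction s using Finset.induction_on with
  | empty => simp
  | insert a s ha ih => rw [Finset.prod_insert ha, Finset.sum_insert ha, v.map_mul, ih]

/-- Strict monotonicity of the valuation of a finite product of nonzero elements. -/
theorem AddValuation.map_prod_lt_map_prod {Ω ι : Type*} [Field Ω]
    (v : AddValuation Ω (WithTop ℝ)) (s : Finset ι) (f g : ι → Ω)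
    (hf : ∀ i ∈ s, f i ≠ 0) (hg : ∀ i ∈ s, g i ≠ 0) (hle : ∀ i ∈ s, v (f i) ≤ v (g i))
    (hlt : ∃ i ∈ s, v (f i) < v (g i)) : v (∏ i ∈ s, f i) < v (∏ i ∈ s, g i) := by
  have key : ∀ h : ι → Ω, (∀ i ∈ s, h i ≠ 0) →
      (∀ i ∈ s, v (h i) = (((v (h i)).untopD 0 : ℝ) : WithTop ℝ)) := by
    intro h hh i hi
    obtain ⟨t, ht⟩ := WithTop.ne_top_iff_exists.mp (v.ne_top_iff.mpr (hh i hi))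
    rw [← ht]
    rfl
  rw [v.map_prod, v.map_prod, Finset.sum_congr rfl (key f hf), Finset.sum_congr rfl (key g hg),
    ← WithTop.coe_sum, ← WithTop.coe_sum, WithTop.coe_lt_coe]
  refine Finset.sum_lt_sum (fun i hi => ?_) ?_
  · have := hle i hi
    rwa [key f hf i hi, key g hg i hi, WithTop.coe_le_coe] at this
  · obtain ⟨i, hi, h⟩ := hlt
    refine ⟨i, hi, ?_⟩
    rwa [key f hf i hi, key g hg i hi, WithTop.coe_lt_coe] at h

namespace AddVal

variable {F Ω : Type*} [Field F] [Field Ω] [Algebra F Ω]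

theorem v_one (V : AddVal Ω) : V.v 1 = 0 := by
  have h := V.v_mul 1 1
  obtain ⟨t, ht⟩ := WithTop.ne_top_iff_exists.mp (V.v_ne_top 1 one_ne_zero)
  rw [mul_one, ← ht, ← WithTop.coe_add, WithTop.coe_inj] at h
  rw [← ht, ← WithTop.coe_zero, WithTop.coe_inj]
  linarith

/-- The additive valuation, in the sense of Mathlib, underlying an `AddVal`. -/
def toAddValuation (V : AddVal Ω) : AddValuation Ω (WithTop ℝ) :=
  AddValuation.of V.v V.v_zero V.v_one V.v_min_le_add V.v_mul

theorem toAddValuation_apply (V : AddVal Ω) (x : Ω) : V.toAddValuation x = V.v x := rfl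

open Polynomial in
/-- A Galois-stable finite set of sum `1` with exactly one element of valuation `0`, all others
having positive valuation: over a Henselian field that element is rational. -/
theorem IsHenselianOn.mem_range_of_sum_eq_one [IsGalois F Ω] {V : AddVal Ω}
    (hV : V.IsHenselianOn F) (Z : Finset Ω) (hZ : ∀ g : Ω ≃ₐ[F] Ω, Z.image g = Z)
    {y : Ω} (hyZ : y ∈ Z) (hy : V.v y = 0) (hpos : ∀ z ∈ Z, z ≠ y → 0 < V.v z)
    (hsum : ∑ z ∈ Z, z = 1) : y ∈ Set.range (algebraMap F Ω) := by
  set v := V.toAddValuation with hv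
  have hnn : ∀ z ∈ Z, 0 ≤ v z := fun z hz => by
    by_cases h : z = y
    · rw [h]; exact hy.ge
    · exact (hpos z hz h).le
  set f : Polynomial Ω := ∏ z ∈ Z, (X - C z) with hf
  set h : Polynomial Ω := ∏ z ∈ Z.erase y, (X - C z) with hh
  have hfac : f = (X - C y) * h := (Finset.mul_prod_erase Z _ hyZ).symm
  have hlift : f ∈ lifts (algebraMap F Ω) := by
    rw [lifts_iff_coeff_lifts]
    intro n
    rw [InfiniteGalois.mem_range_algebraMap_iff_fixed]
    intro g
    have hmap : f.map (g : Ω →+* Ω) = f := by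
      rw [hf, Polynomial.map_prod]
      conv_rhs => rw [← hZ g, Finset.prod_image g.injective.injOn]
      simp
    conv_rhs => rw [← hmap, coeff_map]
    rfl
  obtain ⟨p, hp⟩ := (mem_lifts _).mp hlift
  have h1y : 0 < v (1 - y) := by
    have : 1 - y = ∑ z ∈ Z.erase y, z := by
      rw [← hsum, ← Finset.add_sum_erase Z _ hyZ]; simp
    rw [this]
    refine v.map_lt_sum WithTop.zero_ne_top fun z hz => ?_
    exact hpos z (Finset.mem_of_mem_erase hz) (Finset.ne_of_mem_erase hz)
  have hhc : ∀ i, 0 ≤ v (h.coeff i) := v.coeff_prod_X_sub_C_nonneg _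
    fun z hz => hnn z (Finset.mem_of_mem_erase hz)
  have hev : ∀ q : Polynomial F, algebraMap F Ω (eval 1 q) = eval 1 (q.map (algebraMap F Ω)) := by
    intro q
    rw [eval_map_algebraMap, ← aeval_algebraMap_apply_eq_algebraMap_eval, map_one]
  have hh1 : v (h.eval 1) = 0 := by
    rw [hh, eval_prod, v.map_prod]
    refine Finset.sum_eq_zero fun z hz => ?_
    have hz0 : 0 < v z := hpos z (Finset.mem_of_mem_erase hz) (Finset.ne_of_mem_erase hz)
    have : v 1 < v z := by rwa [v.map_one]
    simpa using v.map_sub_eq_of_lt_left this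
  obtain ⟨a, ha, ha1⟩ := hV p (fun i => by
      rw [← coeff_map, hp]
      exact v.coeff_prod_X_sub_C_nonneg Z hnn i) 1 (by rw [map_one, V.v_one]) (by
      rw [hev, hp, hfac, eval_mul, ← toAddValuation_apply, ← hv, v.map_mul]
      have := v.eval_one_nonneg h hhc
      simpa using add_pos_of_pos_of_nonneg h1y this) (by
      rw [hev, ← derivative_map, hp, hfac, derivative_mul, ← toAddValuation_apply, ← hv]
      have h2 : v (h.eval 1) < v ((1 - y) * h.derivative.eval 1) := by
        rw [hh1, v.map_mul]
        refine add_pos_of_pos_of_nonneg h1y (v.eval_one_nonneg _ fun i => ?_)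
        rw [coeff_derivative, v.map_mul]
        refine add_nonneg (hhc _) ?_
        exact_mod_cast v.natCast_nonneg (i + 1)
      simpa [hh1] using v.map_add_eq_of_lt_left h2)
  have hroot : f.eval (algebraMap F Ω a) = 0 := by
    rw [← hp, eval_map_algebraMap, aeval_algebraMap_apply_eq_algebraMap_eval, ha, map_zero]
  rw [hf, eval_prod, Finset.prod_eq_zero_iff] at hroot
  obtain ⟨z, hz, hz0⟩ := hroot
  have haz : algebraMap F Ω a = z := by simpa [sub_eq_zero] using hz0
  rw [map_sub, map_one, haz] at ha1
  have hvz : v z = v 1 := v.map_eq_of_lt_sub (by rw [v.map_one]; exact ha1)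
  refine ⟨a, ?_⟩
  by_contra hne
  have := hpos z hz (haz ▸ hne)
  rw [← toAddValuation_apply, ← hv, hvz, v.map_one] at this
  exact this.false

end AddVal

section Conjugates

variable (F : Type*) {Ω : Type*} [Field F] [Field Ω] [Algebra F Ω]

/-- The finite set of conjugates of `x` over `F`. -/
def conjFinset (x : Ω) : Finset Ω := ((minpoly F x).aroots Ω).toFinset

theorem mem_conjFinset [IsGalois F Ω] {x z : Ω} :
    z ∈ conjFinset F x ↔ ∃ g : Ω ≃ₐ[F] Ω, g x = z := by
  rw [conjFinset, Multiset.mem_toFinset,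
    ← isConjRoot_iff_mem_minpoly_aroots (Algebra.IsIntegral.isIntegral x),
    IsConjRoot.comm, isConjRoot_iff_exists_algEquiv]

theorem image_conjFinset [IsGalois F Ω] (x : Ω) (g : Ω ≃ₐ[F] Ω) :
    (conjFinset F x).image g = conjFinset F x := by
  ext z
  rw [Finset.mem_image, mem_conjFinset]
  constructor
  · rintro ⟨w, hw, rfl⟩
    obtain ⟨k, rfl⟩ := (mem_conjFinset F).mp hw
    exact ⟨k.trans g, rfl⟩
  · rintro ⟨k, rfl⟩
    exact ⟨g.symm (k x), (mem_conjFinset F).mpr ⟨k.trans g.symm, rfl⟩, by simp⟩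

end Conjugates

namespace AddVal

variable {F Ω : Type*} [Field F] [Field Ω] [Algebra F Ω]

/-- Over a Henselian field, an element whose valuation is strictly smaller than that of all its
other conjugates is rational. -/
theorem IsHenselianOn.mem_range_of_lt_conj [IsGalois F Ω] {V : AddVal Ω}
    (hV : V.IsHenselianOn F) {y : Ω} (hy : ∀ g : Ω ≃ₐ[F] Ω, g y = y ∨ V.v y < V.v (g y)) :
    y ∈ Set.range (algebraMap F Ω) := by
  by_cases hy0 : y = 0
  · exact ⟨0, by simp [hy0]⟩
  set v := V.toAddValuation with hv
  set R := conjFinset F y with hR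
  have hyR : y ∈ R := (mem_conjFinset F).mpr ⟨AlgEquiv.refl, rfl⟩
  have hlt : ∀ z ∈ R, z ≠ y → v y < v z := by
    intro z hz hne
    obtain ⟨g, rfl⟩ := (mem_conjFinset F).mp hz
    exact (hy g).resolve_left hne
  set u := ∑ z ∈ R, z with hu
  have huv : v u = v y := by
    rw [hu, ← Finset.add_sum_erase R _ hyR]
    refine v.map_add_eq_of_lt_left (v.map_lt_sum (v.ne_top_iff.mpr hy0) fun z hz => ?_)
    exact hlt z (Finset.mem_of_mem_erase hz) (Finset.ne_of_mem_erase hz)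
  have hu0 : u ≠ 0 := by
    rw [← v.ne_top_iff, huv, v.ne_top_iff]
    exact hy0
  have hgu : ∀ g : Ω ≃ₐ[F] Ω, g u = u := by
    intro g
    rw [hu, map_sum]
    conv_rhs => rw [hR, ← image_conjFinset F y g, Finset.sum_image g.injective.injOn]
  obtain ⟨t, ht⟩ := (InfiniteGalois.mem_range_algebraMap_iff_fixed u).mpr hgu
  have hmul : ∀ z, v z = v (z / u) + v u := by
    intro z
    rw [← v.map_mul, div_mul_cancel₀ _ hu0]
  have hutop : v u ≠ ⊤ := v.ne_top_iff.mpr hu0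
  obtain ⟨a, ha⟩ := hV.mem_range_of_sum_eq_one (R.image (· / u)) (y := y / u) (by
      intro g
      conv_rhs => rw [hR, ← image_conjFinset F y g]
      rw [Finset.image_image, Finset.image_image]
      refine Finset.image_congr fun z _ => ?_
      simp [hgu g]) (Finset.mem_image_of_mem _ hyR) (by
      have h : v u + 0 = v u + v (y / u) := by
        rw [add_zero, add_comm, ← hmul, huv]
      exact ((WithTop.add_left_inj hutop).mp h).symm) (by
      intro w hw hne
      obtain ⟨z, hz, rfl⟩ := Finset.mem_image.mp hw
      have h := hlt z hz (fun h => hne (by rw [h]))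
      rw [← huv, hmul z] at h
      by_contra hcon
      refine h.not_ge ?_
      calc v (z / u) + v u ≤ 0 + v u := by gcongr; exact not_lt.mp hcon
        _ = v u := zero_add _) (by
      rw [Finset.sum_image (fun a _ b _ h => by simpa [div_left_inj' hu0] using h),
        ← Finset.sum_div, ← hu, div_self hu0])
  exact ⟨a * t, by rw [map_mul, ha, ht, div_mul_cancel₀ _ hu0]⟩

/-- A valuation extending a Henselian one is Galois invariant. -/
theorem IsHenselianOn.v_algEquiv [IsGalois F Ω] {V : AddVal Ω}
    (hV : V.IsHenselianOn F) (g : Ω ≃ₐ[F] Ω) (x : Ω) : V.v (g x) = V.v x := by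
  by_cases hx : x = 0
  · simp [hx]
  set v := V.toAddValuation with hv
  set R := conjFinset F x with hR
  obtain ⟨x₀, hx₀R, hmin⟩ := R.exists_min_image v
    ⟨x, (mem_conjFinset F).mpr ⟨AlgEquiv.refl, rfl⟩⟩
  set S := R.filter (fun z => v z = v x₀) with hS
  have hne : ∀ z ∈ S, z ≠ 0 := by
    intro z hz
    obtain ⟨k, rfl⟩ := (mem_conjFinset F).mp (Finset.mem_filter.mp hz).1
    simpa using hx
  have hRk : ∀ k : Ω ≃ₐ[F] Ω, ∀ z ∈ R, k z ∈ R := by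
    intro k z hz
    rw [hR, ← image_conjFinset F x k]
    exact Finset.mem_image_of_mem _ hz
  have hcase : ∀ k : Ω ≃ₐ[F] Ω, S.image k = S ∨ v (∏ z ∈ S, z) < v (k (∏ z ∈ S, z)) := by
    intro k
    refine or_iff_not_imp_left.mpr fun hk => ?_
    rw [_root_.map_prod k]
    refine v.map_prod_lt_map_prod S _ _ hne (fun z hz => by simpa using hne z hz) ?_ ?_
    · intro z hz
      rw [(Finset.mem_filter.mp hz).2]
      exact hmin _ (hRk k z (Finset.mem_filter.mp hz).1)
    · by_contra! hcon
      refine hk (Finset.eq_of_subset_of_card_le ?_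
        (Finset.card_image_of_injective S k.injective).ge)
      intro w hw
      obtain ⟨z, hz, rfl⟩ := Finset.mem_image.mp hw
      have hkz := hRk k z (Finset.mem_filter.mp hz).1
      refine Finset.mem_filter.mpr ⟨hkz, le_antisymm ?_ (hmin _ hkz)⟩
      rw [← (Finset.mem_filter.mp hz).2]
      exact hcon z hz
  obtain ⟨a, ha⟩ := hV.mem_range_of_lt_conj (y := ∏ z ∈ S, z) (by
    intro k
    refine (hcase k).imp_left fun hk => ?_
    rw [map_prod]
    conv_rhs => rw [← hk, Finset.prod_image k.injective.injOn])
  have himg : ∀ k : Ω ≃ₐ[F] Ω, S.image k = S := by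
    intro k
    refine (hcase k).resolve_right ?_
    rw [← ha, AlgEquiv.commutes]
    exact lt_irrefl _
  have hconst : ∀ k : Ω ≃ₐ[F] Ω, v (k x₀) = v x₀ := by
    intro k
    have : k x₀ ∈ S := by
      rw [← himg k]
      exact Finset.mem_image_of_mem _ (Finset.mem_filter.mpr ⟨hx₀R, rfl⟩)
    exact (Finset.mem_filter.mp this).2
  obtain ⟨k, hk⟩ := (mem_conjFinset F).mp hx₀R
  have hxk : x = k.symm x₀ := by rw [← hk, AlgEquiv.symm_apply_apply]
  have h1 := hconst (k.symm.trans g)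
  have h2 := hconst k.symm
  rw [AlgEquiv.trans_apply, ← hxk] at h1
  rw [← hxk] at h2
  exact h1.trans h2.symm

theorem IsHenselianOn.v_intermediateField_algEquiv [IsGalois F Ω] {V : AddVal Ω}
    (hV : V.IsHenselianOn F) (M : IntermediateField F Ω) (γ : M ≃ₐ[F] M) (m : M) :
    V.v (γ m : Ω) = V.v (m : Ω) := by
  have h : IsConjRoot F ((γ m : M) : Ω) (m : Ω) :=
    (isConjRoot_algHom_iff M.val).mpr (isConjRoot_of_algEquiv' m γ)
  obtain ⟨g, hg⟩ := isConjRoot_iff_exists_algEquiv.mp h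
  rw [← hg, hV.v_algEquiv]

theorem IsHenselianOn.xiRel_comp_iff [IsGalois F Ω] {V : AddVal Ω}
    (hV : V.IsHenselianOn F) (E : IntermediateField F Ω) (e : ℕ) (r : ℝ) (g : Ω ≃ₐ[F] Ω)
    (σ τ : E →ₐ[F] Ω) :
    xiRel V E e r (g.toAlgHom.comp σ) (g.toAlgHom.comp τ) ↔ xiRel V E e r σ τ := by
  refine forall₂_congr fun x _ => ?_
  have : (g.toAlgHom.comp σ) x - (g.toAlgHom.comp τ) x = g (σ x - τ x) := by simp
  rw [this, hV.v_algEquiv]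

end AddVal

theorem xiRel_refl {F Ω : Type*} [Field F] [Field Ω] [Algebra F Ω] (V : AddVal Ω)
    (E : IntermediateField F Ω) (e : ℕ) (r : ℝ) (σ : E →ₐ[F] Ω) : xiRel V E e r σ σ := by
  intro x _
  rw [sub_self, V.v_zero]
  exact le_top

/-- Any two embeddings of a field into a normal extension differ by an automorphism. -/
theorem AlgHom.exists_algEquiv_comp_eq {F E Ω : Type*} [Field F] [Field E] [Field Ω]
    [Algebra F E] [Algebra F Ω] [Normal F Ω] (σ τ : E →ₐ[F] Ω) :
    ∃ g : Ω ≃ₐ[F] Ω, ∀ x, g (σ x) = τ x := by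
  let χ : σ.fieldRange ≃ₐ[F] τ.fieldRange :=
    (AlgEquiv.ofInjectiveField σ).symm.trans (AlgEquiv.ofInjectiveField τ)
  refine ⟨χ.liftNormal Ω, fun x => ?_⟩
  have h := χ.liftNormal_commutes Ω (AlgEquiv.ofInjectiveField σ x)
  have h2 : χ (AlgEquiv.ofInjectiveField σ x) = AlgEquiv.ofInjectiveField τ x :=
    congrArg (AlgEquiv.ofInjectiveField τ) ((AlgEquiv.ofInjectiveField σ).symm_apply_apply x)
  rw [h2] at h
  exact h

/-- Let `M/F` be a finitely ramified Galois extension inside `F^sep`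
containing a normal closure of `E`.  Then `Gal(M/F)` acts on `Hom_{F-alg}(E, F^sep)` by
post-composition; this action descends to a well-defined transitive action on the set of
`Ξ_r`-equivalence classes, and consequently all `Ξ_r`-classes have the same cardinality. -/
theorem galois_action_on_xiRel_classes
    {F Ω : Type*} [Field F] [Field Ω] [Algebra F Ω] [IsSepClosure F Ω]
    (V : AddVal Ω) (hnorm : V.IsNormalizedOn F) (hhens : V.IsHenselianOn F)
    (hperf : V.HasPerfectResidueFieldOn F)
    (E : IntermediateField F Ω) (e : ℕ) (he : V.IsRamIdx E e)
    (r : ℝ) (hr : -1 ≤ r)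
    (M : IntermediateField F Ω) (eM : ℕ) (hM : V.IsRamIdx M eM) (hGal : IsGalois F ↥M)
    (hNC : ∀ (ρ : ↥E →ₐ[F] Ω) (x : ↥E), ρ x ∈ M) :
    -- (a) post-composition by `γ ∈ Gal(M/F)` preserves the relation `Ξ_r`,
    -- so the action on classes is well defined
    (∀ (γ : ↥M ≃ₐ[F] ↥M) (σ τ ρσ ρτ : ↥E →ₐ[F] Ω),
      (∀ x : ↥E, ρσ x = ((γ ⟨σ x, hNC σ x⟩ : ↥M) : Ω)) →
      (∀ x : ↥E, ρτ x = ((γ ⟨τ x, hNC τ x⟩ : ↥M) : Ω)) →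
      xiRel V E e r σ τ → xiRel V E e r ρσ ρτ) ∧
    -- (b) the induced action on `Ξ_r`-classes is transitive
    (∀ σ τ : ↥E →ₐ[F] Ω, ∃ (γ : ↥M ≃ₐ[F] ↥M) (ρ : ↥E →ₐ[F] Ω),
      (∀ x : ↥E, ρ x = ((γ ⟨σ x, hNC σ x⟩ : ↥M) : Ω)) ∧ xiRel V E e r ρ τ) ∧
    -- (c) consequently all `Ξ_r`-classes have the same cardinality
    (∀ σ τ : ↥E →ₐ[F] Ω,
      Nat.card {ρ : ↥E →ₐ[F] Ω // xiRel V E e r ρ σ} =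
        Nat.card {ρ : ↥E →ₐ[F] Ω // xiRel V E e r ρ τ}) := by
  have : IsGalois F Ω := inferInstance
  refine ⟨?_, ?_, ?_⟩
  · intro γ σ τ ρσ ρτ hσ hτ h x hx
    have hsub : ρσ x - ρτ x = ((γ (⟨σ x, hNC σ x⟩ - ⟨τ x, hNC τ x⟩) : ↥M) : Ω) := by
      rw [hσ, hτ, map_sub]
      rfl
    rw [hsub, hhens.v_intermediateField_algEquiv]
    exact h x hx
  · intro σ τ
    obtain ⟨g, hg⟩ := AlgHom.exists_algEquiv_comp_eq σ τ
    refine ⟨g.restrictNormal M, τ, fun x => ?_, xiRel_refl V E e r τ⟩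
    rw [← hg x]
    exact (g.restrictNormal_commutes M ⟨σ x, hNC σ x⟩).symm
  · intro σ τ
    obtain ⟨g, hg⟩ := AlgHom.exists_algEquiv_comp_eq σ τ
    have hgσ : g.toAlgHom.comp σ = τ := AlgHom.ext hg
    let Φ : (↥E →ₐ[F] Ω) ≃ (↥E →ₐ[F] Ω) :=
      { toFun := fun ρ => g.toAlgHom.comp ρ
        invFun := fun ρ => g.symm.toAlgHom.comp ρ
        left_inv := fun ρ => AlgHom.ext fun x => g.symm_apply_apply (ρ x)
        right_inv := fun ρ => AlgHom.ext fun x => g.apply_symm_apply (ρ x) }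
    refine Nat.card_congr (Φ.subtypeEquiv fun ρ => ?_)
    rw [← hgσ]
    exact (hhens.xiRel_comp_iff E e r g ρ σ).symm
end
end

section
/- Let F be a discretely valued Henselian field with perfect residue field and E/F a finitely ramified separable algebraic extension. If r > −1 and σ, τ : E → F^sep are F-algebra embeddings which are Ξ_r-equivalent, then σ and τ agree on the maximal unramified subextension of E/F. Consequently, for every r > −1, the common cardinality g_r of the Ξ_r-equivalence classes satisfies 1 ≤ g_r ≤ e(E/F). -/
noncomputable section

open scoped Classical

/-- `U/K` is an unramified subextension, i.e. is "at most 0-ramified": the relation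
`Ξ^0 = Ξ_0` on `K`-algebra embeddings of `U` is trivial. -/
def IsUnramifiedSubext {Ω : Type*} [Field Ω] (V : AddVal Ω) {K : Type*} [Field K]
    [Algebra K Ω] (U : IntermediateField K Ω) : Prop :=
  ∀ eU : ℕ, V.IsRamIdx U eU → ∀ σ τ : ↥U →ₐ[K] Ω, xiRel V U eU 0 σ τ → σ = τ


namespace AddVal

variable {Ω : Type*} [Field Ω]

/-- The real absolute value `exp (-v x)` attached to an additive valuation. -/
def absFun (V : AddVal Ω) (x : Ω) : ℝ :=
  if x = 0 then 0 else Real.exp (-(V.v x).untopD 0)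

variable (V : AddVal Ω)

lemma absFun_zero : V.absFun 0 = 0 := by simp [absFun]

lemma absFun_pos {x : Ω} (hx : x ≠ 0) : 0 < V.absFun x := by
  simp [absFun, hx, Real.exp_pos]

lemma absFun_nonneg (x : Ω) : 0 ≤ V.absFun x := by
  rcases eq_or_ne x 0 with rfl | hx
  · exact V.absFun_zero.ge
  · exact (V.absFun_pos hx).le

lemma coe_le_v_iff (c : ℝ) (x : Ω) :
    (c : WithTop ℝ) ≤ V.v x ↔ V.absFun x ≤ Real.exp (-c) := by
  rcases eq_or_ne x 0 with rfl | hx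
  · simp [V.v_zero, absFun_zero, Real.exp_nonneg]
  · obtain ⟨y, hy⟩ := WithTop.ne_top_iff_exists.1 (V.v_ne_top x hx)
    simp [absFun, hx, ← hy]

lemma v_eq_coe_iff (c : ℝ) (x : Ω) :
    V.v x = (c : WithTop ℝ) ↔ V.absFun x = Real.exp (-c) := by
  rcases eq_or_ne x 0 with rfl | hx
  · simp [V.v_zero, absFun_zero, (Real.exp_pos _).ne]
  · obtain ⟨y, hy⟩ := WithTop.ne_top_iff_exists.1 (V.v_ne_top x hx)
    simp [absFun, hx, ← hy]

lemma coe_lt_v_iff (c : ℝ) (x : Ω) :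
    (c : WithTop ℝ) < V.v x ↔ V.absFun x < Real.exp (-c) := by
  rw [lt_iff_le_and_ne, lt_iff_le_and_ne, coe_le_v_iff, ne_comm, ne_eq, v_eq_coe_iff]

lemma v_nonneg_iff (x : Ω) : 0 ≤ V.v x ↔ V.absFun x ≤ 1 := by
  simpa using V.coe_le_v_iff 0 x

lemma v_pos_iff (x : Ω) : 0 < V.v x ↔ V.absFun x < 1 := by
  simpa using V.coe_lt_v_iff 0 x

lemma v_eq_zero_iff (x : Ω) : V.v x = 0 ↔ V.absFun x = 1 := by
  simpa using V.v_eq_coe_iff 0 x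

lemma absFun_mul (x y : Ω) : V.absFun (x * y) = V.absFun x * V.absFun y := by
  rcases eq_or_ne x 0 with rfl | hx
  · simp [absFun_zero]
  rcases eq_or_ne y 0 with rfl | hy
  · simp [absFun_zero]
  obtain ⟨a, ha⟩ := WithTop.ne_top_iff_exists.1 (V.v_ne_top x hx)
  obtain ⟨b, hb⟩ := WithTop.ne_top_iff_exists.1 (V.v_ne_top y hy)
  have h : V.v (x * y) = ((a + b : ℝ) : WithTop ℝ) := by
    rw [V.v_mul, ← ha, ← hb, WithTop.coe_add]
  rw [(V.v_eq_coe_iff _ _).1 h, (V.v_eq_coe_iff _ _).1 ha.symm, (V.v_eq_coe_iff _ _).1 hb.symm,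
    ← Real.exp_add]
  congr 1
  ring

lemma absFun_add_le_max (x y : Ω) :
    V.absFun (x + y) ≤ max (V.absFun x) (V.absFun y) := by
  rcases eq_or_ne x 0 with rfl | hx
  · simp
  rcases eq_or_ne y 0 with rfl | hy
  · simp
  obtain ⟨a, ha⟩ := WithTop.ne_top_iff_exists.1 (V.v_ne_top x hx)
  obtain ⟨b, hb⟩ := WithTop.ne_top_iff_exists.1 (V.v_ne_top y hy)
  have h := V.v_min_le_add x y
  rw [← ha, ← hb, ← WithTop.coe_min, coe_le_v_iff] at h
  refine h.trans ?_
  rw [(V.v_eq_coe_iff _ _).1 ha.symm, (V.v_eq_coe_iff _ _).1 hb.symm]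
  rcases le_total a b with hab | hab <;> simp [hab]

/-- `AddVal.absFun` as a bundled absolute value. -/
def abs : AbsoluteValue Ω ℝ where
  toFun := V.absFun
  map_mul' := V.absFun_mul
  nonneg' := V.absFun_nonneg
  eq_zero' _ := ⟨fun h ↦ by_contra fun hx ↦ (V.absFun_pos hx).ne' h, fun h ↦ h ▸ V.absFun_zero⟩
  add_le' x y := (V.absFun_add_le_max x y).trans
    (max_le_add_of_nonneg (V.absFun_nonneg x) (V.absFun_nonneg y))

lemma abs_apply (x : Ω) : V.abs x = V.absFun x := rfl

lemma isNonarchimedean_abs : IsNonarchimedean V.abs := V.absFun_add_le_max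

lemma abs_sub_comm (x y : Ω) : V.abs (x - y) = V.abs (y - x) := by
  rw [← neg_sub, AbsoluteValue.map_neg]

lemma abs_sub_le_max (x y : Ω) : V.abs (x - y) ≤ max (V.abs x) (V.abs y) := by
  simpa [sub_eq_add_neg, AbsoluteValue.map_neg] using V.isNonarchimedean_abs x (-y)

lemma abs_sub_lt {x y z : Ω} {c : ℝ} (h₁ : V.abs (x - y) < c) (h₂ : V.abs (y - z) < c) :
    V.abs (x - z) < c := by
  have h := V.isNonarchimedean_abs (x - y) (y - z)
  rw [sub_add_sub_cancel] at h
  exact h.trans_lt (max_lt h₁ h₂)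

/-- The valuation ring of an additive valuation. -/
def valRing : ValuationSubring Ω where
  carrier := {x | V.abs x ≤ 1}
  mul_mem' {x y} hx hy := by
    simpa using mul_le_one₀ hx (V.abs.nonneg y) hy
  one_mem' := by simp
  add_mem' {x y} hx hy := (V.isNonarchimedean_abs x y).trans (max_le hx hy)
  zero_mem' := by simp
  neg_mem' hx := by simpa [AbsoluteValue.map_neg] using hx
  mem_or_inv_mem' x := by
    rcases le_total (V.abs x) 1 with h | h
    · exact Or.inl h
    · right
      simpa using inv_le_one_of_one_le₀ h

lemma mem_valRing {x : Ω} : x ∈ V.valRing ↔ V.abs x ≤ 1 := Iff.rfl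

lemma residue_eq_zero_iff (x : V.valRing) :
    IsLocalRing.residue V.valRing x = 0 ↔ V.abs (x : Ω) < 1 := by
  rw [IsLocalRing.residue_eq_zero_iff, IsLocalRing.mem_maximalIdeal, mem_nonunits_iff]
  constructor
  · intro h
    refine lt_of_le_of_ne x.2 fun h1 ↦ h ?_
    have hx : (x : Ω) ≠ 0 := by
      intro h0
      simp [h0] at h1
    exact IsUnit.of_mul_eq_one ⟨(x : Ω)⁻¹, by simp [mem_valRing, h1]⟩
      (Subtype.ext (mul_inv_cancel₀ hx))
  · intro h hu
    obtain ⟨y, hy⟩ := hu.exists_right_inv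
    have hy' : (x : Ω) * (y : Ω) = 1 := congrArg Subtype.val hy
    have h1 : V.abs (x : Ω) * V.abs (y : Ω) = 1 := by rw [← map_mul, hy', map_one]
    have h2 : V.abs (y : Ω) ≤ 1 := y.2
    nlinarith [V.abs.nonneg (x : Ω), V.abs.nonneg (y : Ω)]

section

variable {V}

lemma exists_abs_lt_one_of_multiset_prod (s : Multiset Ω) (h : V.abs s.prod < 1) :
    ∃ a ∈ s, V.abs a < 1 := by
  by_contra! hs
  induction s using Multiset.induction_on with
  | empty => simp at h
  | cons a s ih =>
    refine ih (lt_of_le_of_lt ?_ h) fun b hb ↦ hs b (Multiset.mem_cons_of_mem hb)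
    rw [Multiset.prod_cons, map_mul]
    exact le_mul_of_one_le_left (V.abs.nonneg _) (hs a (Multiset.mem_cons_self a s))

end

end AddVal

section HenselUniqueness

open Polynomial

variable {F N : Type*} [Field F] [Field N] [Algebra F N]

lemma IsNonarchimedean.abs_sub_le {A : AbsoluteValue N ℝ} (hA : IsNonarchimedean A) (x y : N) :
    A (x - y) ≤ max (A x) (A y) := by
  simpa [sub_eq_add_neg, AbsoluteValue.map_neg] using hA x (-y)

lemma IsNonarchimedean.prod_X_sub_C_integral {A : AbsoluteValue N ℝ} (hA : IsNonarchimedean A)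
    (s : Multiset N) (hs : ∀ a ∈ s, A a ≤ 1) :
    (∀ i, A ((s.map fun a ↦ X - C a).prod.coeff i) ≤ 1) ∧
      A ((s.map fun a ↦ X - C a).prod.eval 1) ≤ 1 ∧
      A ((derivative (s.map fun a ↦ X - C a).prod).eval 1) ≤ 1 := by
  induction s using Multiset.induction_on with
  | empty =>
    refine ⟨fun i ↦ ?_, by simp, by simp⟩
    rcases eq_or_ne i 0 with rfl | hi <;> simp [coeff_one, *]
  | cons a s ih =>
    obtain ⟨h₁, h₂, h₃⟩ := ih fun b hb ↦ hs b (Multiset.mem_cons_of_mem hb)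
    have ha := hs a (Multiset.mem_cons_self a s)
    have h1a : A (1 - a) ≤ 1 := (hA.abs_sub_le 1 a).trans (max_le (by simp) ha)
    rw [Multiset.map_cons, Multiset.prod_cons]
    set p := (s.map fun a ↦ X - C a).prod
    refine ⟨fun i ↦ ?_, ?_, ?_⟩
    · have haux : ∀ j, A (a * p.coeff j) ≤ 1 := fun j ↦ by
        rw [map_mul]
        exact mul_le_one₀ ha (A.nonneg _) (h₁ j)
      rw [sub_mul, coeff_sub, coeff_C_mul]
      refine (hA.abs_sub_le _ _).trans (max_le ?_ (haux i))
      cases i with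
      | zero => simp
      | succ i => rw [coeff_X_mul]; exact h₁ i
    · rw [eval_mul, map_mul]
      exact mul_le_one₀ (by simpa using h1a) (A.nonneg _) h₂
    · have : (derivative ((X - C a) * p)).eval 1 = p.eval 1 + (1 - a) * (derivative p).eval 1 := by
        simp
      rw [this]
      refine (hA _ _).trans (max_le h₂ ?_)
      rw [map_mul]
      exact mul_le_one₀ h1a (A.nonneg _) h₃

/-- Weak approximation for the Galois conjugates of an absolute value. -/
lemma exists_abs_sub_one_lt_and_abs_conj_lt [FiniteDimensional F N]
    {A : AbsoluteValue N ℝ} (hA : IsNonarchimedean A) {ϖ : F} (hϖ₀ : 0 < A (algebraMap F N ϖ))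
    (hϖ₁ : A (algebraMap F N ϖ) < 1) :
    ∃ b : N, A (b - 1) < 1 ∧
      ∀ γ : N ≃ₐ[F] N, (∃ y, A (γ y) ≠ A y) → A (γ b) < 1 := by
  let w : (N ≃ₐ[F] N) → AbsoluteValue N ℝ := fun γ ↦ A.comp (f := (γ : N →+* N)) γ.injective
  have hw : ∀ γ y, w γ y = A (γ y) := fun _ _ ↦ rfl
  have hwϖ : ∀ γ, w γ (algebraMap F N ϖ) = A (algebraMap F N ϖ) := fun γ ↦ by simp [hw]
  have hϖne : algebraMap F N ϖ ≠ 0 := fun h ↦ by simp [h] at hϖ₀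
  have hsurj : ∀ i : Set.range w, ∃ γ, w γ = i := fun i ↦ i.2
  have key := AbsoluteValue.exists_one_lt_lt_one_pi_of_not_isEquiv
    (v := fun i : Set.range w ↦ (i : AbsoluteValue N ℝ))
    (fun i ↦ by
      obtain ⟨γ, hγ⟩ := hsurj i
      exact ⟨algebraMap F N ϖ, hϖne, by rw [← hγ, hwϖ]; exact hϖ₁.ne⟩)
    (fun i j hij h ↦ by
      obtain ⟨γ, hγ⟩ := hsurj i
      obtain ⟨δ, hδ⟩ := hsurj j
      obtain ⟨c, -, hc⟩ := AbsoluteValue.isEquiv_iff_exists_rpow_eq.1 h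
      have h1 := congrFun hc (algebraMap F N ϖ)
      simp only [← hγ, ← hδ, hwϖ] at h1
      have hc1 : c = 1 := by
        have := congrArg Real.log h1
        rw [Real.log_rpow hϖ₀] at this
        have hlog := Real.log_neg hϖ₀ hϖ₁
        exact mul_right_cancel₀ hlog.ne (by rw [this, one_mul])
      refine hij (Subtype.ext (AbsoluteValue.ext fun y ↦ ?_))
      have := congrFun hc y
      simpa [hc1] using this)
  obtain ⟨a, ha, ha'⟩ := key ⟨w 1, 1, rfl⟩
  have ha1 : 1 < A a := ha
  have hsum : A (1 + a) = A a := by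
    have h := hA.add_eq_max_of_ne (x := 1) (y := a) (by rw [map_one]; exact ha1.ne)
    rw [h, map_one, max_eq_right ha1.le]
  have hne : 1 + a ≠ 0 := fun h ↦ by
    rw [h, map_zero] at hsum
    linarith
  refine ⟨a / (1 + a), ?_, fun γ ⟨y, hy⟩ ↦ ?_⟩
  · have : a / (1 + a) - 1 = -(1 + a)⁻¹ := by field_simp; ring
    rw [this, AbsoluteValue.map_neg, map_inv₀, hsum]
    exact inv_lt_one_of_one_lt₀ ha1
  · have hγ : A (γ a) < 1 := ha' ⟨w γ, γ, rfl⟩ fun h ↦ hy (by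
      have := congrArg Subtype.val h
      exact DFunLike.congr_fun this y)
    have h := hA.add_eq_max_of_ne (x := 1) (y := γ a) (by rw [map_one]; exact hγ.ne')
    rw [map_one, max_eq_left hγ.le] at h
    rw [map_div₀, map_add, map_one, map_div₀, h, div_one]
    exact hγ

/-- Over a field with Hensel's lemma, the extension of the absolute value to a finite Galois
extension is Galois invariant. -/
theorem abs_algEquiv_apply_of_hensel [FiniteDimensional F N] [IsGalois F N]
    {A : AbsoluteValue N ℝ} (hA : IsNonarchimedean A) {ϖ : F} (hϖ₀ : 0 < A (algebraMap F N ϖ))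
    (hϖ₁ : A (algebraMap F N ϖ) < 1)
    (hens : ∀ f : F[X], (∀ i, A (algebraMap F N (f.coeff i)) ≤ 1) →
      A (algebraMap F N (f.eval 1)) < 1 → A (algebraMap F N ((derivative f).eval 1)) = 1 →
      ∃ a : F, f.eval a = 0)
    (γ : N ≃ₐ[F] N) (y : N) : A (γ y) = A y := by
  by_contra hγ
  obtain ⟨b, hb, hb'⟩ := exists_abs_sub_one_lt_and_abs_conj_lt (F := F) hA hϖ₀ hϖ₁
  let D : Subgroup (N ≃ₐ[F] N) :=
    { carrier := {δ | ∀ y, A (δ y) = A y}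
      mul_mem' := fun {δ ε} hδ hε y ↦ by rw [AlgEquiv.mul_apply, hδ, hε]
      one_mem' := fun y ↦ rfl
      inv_mem' := fun {δ} hδ y ↦ by
        rw [← hδ (δ⁻¹ y), ← AlgEquiv.mul_apply, mul_inv_cancel, AlgEquiv.one_apply] }
  have hD : ∀ {δ}, δ ∈ D ↔ ∀ y, A (δ y) = A y := Iff.rfl
  have hsmall : ∀ δ, δ ∉ D → A (δ b) < 1 := fun δ hδ ↦ hb' δ (by simpa [hD] using hδ)
  let β : N := ∏ δ : D, (δ : N ≃ₐ[F] N) b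
  have hβ1 : A (β - 1) < 1 := by
    refine Finset.prod_induction (fun δ : D ↦ (δ : N ≃ₐ[F] N) b) (fun z ↦ A (z - 1) < 1)
      (fun x z hx hz ↦ ?_) (by simp) fun δ _ ↦ ?_
    · have h1 : A z ≤ 1 := by
        have := hA (z - 1) 1
        rw [sub_add_cancel, map_one] at this
        exact this.trans (max_le hz.le le_rfl)
      have : x * z - 1 = (x - 1) * z + (z - 1) := by ring
      rw [this]
      refine (hA _ _).trans_lt (max_lt ?_ hz)
      rw [map_mul]
      exact mul_lt_one_of_nonneg_of_lt_one_left (A.nonneg _) hx h1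
    · have := hD.1 δ.2 (b - 1)
      rw [map_sub, map_one] at this
      rwa [this]
  have hβA : A β = 1 := by
    have h := hA.add_eq_max_of_ne (x := β - 1) (y := 1) (by rw [map_one]; exact hβ1.ne)
    rwa [sub_add_cancel, map_one, max_eq_right hβ1.le] at h
  have hβfix : ∀ ε ∈ D, ε β = β := fun ε hε ↦ by
    simp only [β, map_prod]
    exact Fintype.prod_equiv (Equiv.mulLeft (⟨ε, hε⟩ : D)) _ _ fun δ ↦ rfl
  have hβsmall : ∀ ε, ε ∉ D → A (ε β) < 1 := fun ε hε ↦ by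
    simp only [β, map_prod]
    have hlt : ∀ δ : D, A (ε ((δ : N ≃ₐ[F] N) b)) < 1 := fun δ ↦
      hsmall (ε * δ) fun h ↦ hε ((D.mul_mem_cancel_right δ.2).1 h)
    rw [← Finset.mul_prod_erase _ _ (Finset.mem_univ (1 : D))]
    refine mul_lt_one_of_nonneg_of_lt_one_left (A.nonneg _) (hlt 1) ?_
    exact Finset.prod_le_one (fun _ _ ↦ A.nonneg _) fun δ _ ↦ (hlt δ).le
  have hβint : IsIntegral F β := Algebra.IsIntegral.isIntegral β
  set f := minpoly F β with hf
  have hroot : ∀ a ∈ f.aroots N, a ≠ β → A a < 1 := fun a ha hne ↦ by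
    obtain ⟨ε, rfl⟩ := minpoly.exists_algEquiv_of_root' (K := F) hβint.isAlgebraic
      (mem_aroots.1 ha).2
    exact hβsmall ε fun h ↦ hne (hβfix ε h)
  have hβmem : β ∈ f.aroots N := mem_aroots.2 ⟨minpoly.ne_zero hβint, minpoly.aeval F β⟩
  have hnodup : (f.aroots N).Nodup := nodup_roots (Separable.map (Algebra.IsSeparable.isSeparable F β))
  obtain ⟨s, hs⟩ := Multiset.exists_cons_of_mem hβmem
  have hsβ : β ∉ s := by
    rw [hs, Multiset.nodup_cons] at hnodup
    exact hnodup.1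
  have hslt : ∀ a ∈ s, A a < 1 := fun a ha ↦
    hroot a (hs ▸ Multiset.mem_cons_of_mem ha) fun h ↦ hsβ (h ▸ ha)
  have hfprod : f.map (algebraMap F N) = ((β ::ₘ s).map fun a ↦ X - C a).prod := by
    rw [← hs]
    exact (Normal.splits inferInstance β).eq_prod_roots_of_monic ((minpoly.monic hβint).map _)
  have hev : ∀ p : F[X], algebraMap F N (p.eval 1) = (p.map (algebraMap F N)).eval 1 := fun p ↦
    (eval_one_map _ p).symm
  have hall := hA.prod_X_sub_C_integral (β ::ₘ s) (by
    intro a ha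
    rcases Multiset.mem_cons.1 ha with rfl | ha
    · exact hβA.le
    · exact (hslt a ha).le)
  have hs' := hA.prod_X_sub_C_integral s fun a ha ↦ (hslt a ha).le
  set g := (s.map fun a ↦ X - C a).prod with hg
  have hfg : f.map (algebraMap F N) = (X - C β) * g := by
    rw [hfprod, Multiset.map_cons, Multiset.prod_cons]
  have hβ1' : A (1 - β) < 1 := by rwa [← neg_sub, AbsoluteValue.map_neg]
  have hg1 : A (g.eval 1) = 1 := by
    have : g.eval 1 = (s.map fun a ↦ 1 - a).prod := by
      rw [hg, eval_multiset_prod, Multiset.map_map]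
      simp
    rw [this]
    refine Multiset.prod_induction (fun z ↦ A z = 1) _ (fun x z hx hz ↦ ?_) (by simp) fun z hz ↦ ?_
    · rw [map_mul, hx, hz, one_mul]
    · obtain ⟨a, ha, rfl⟩ := Multiset.mem_map.1 hz
      have h := hA.add_eq_max_of_ne (x := 1) (y := -a)
        (by rw [map_one, AbsoluteValue.map_neg]; exact (hslt a ha).ne')
      rwa [← sub_eq_add_neg, map_one, AbsoluteValue.map_neg, max_eq_left (hslt a ha).le] at h
  obtain ⟨a, ha⟩ := hens f
    (fun i ↦ by rw [← coeff_map, hfprod]; exact hall.1 i)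
    (by
      rw [hev, hfg, eval_mul, map_mul, hg1, mul_one]
      simpa using hβ1')
    (by
      rw [hev, ← derivative_map, hfg]
      have : (derivative ((X - C β) * g)).eval 1
          = g.eval 1 + (1 - β) * (derivative g).eval 1 := by
        simp
      have hlt : A ((1 - β) * (derivative g).eval 1) < 1 := by
        rw [map_mul]
        exact mul_lt_one_of_nonneg_of_lt_one_left (A.nonneg _) hβ1' hs'.2.2
      rw [this, hA.add_eq_max_of_ne (by rw [hg1]; exact hlt.ne'), hg1, max_eq_left hlt.le])
  have hβF : algebraMap F N a = β := minpoly.root hβint ha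
  have hγD : γ ∉ D := fun h ↦ hγ (h y)
  have := hβsmall γ hγD
  rw [← hβF, AlgEquiv.commutes, hβF, hβA] at this
  exact lt_irrefl _ this

end HenselUniqueness

open Polynomial in
/-- A monic polynomial over an integrally closed local domain with separable reduction is
separable over the fraction field. -/
lemma Polynomial.Monic.separable_map_of_residue {R K : Type*} [CommRing R] [IsDomain R]
    [IsIntegrallyClosed R] [IsLocalRing R] [Field K] [Algebra R K] [IsFractionRing R K]
    {g : R[X]} (hg : g.Monic) (hsep : (g.map (IsLocalRing.residue R)).Separable) :
    (g.map (algebraMap R K)).Separable := by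
  have hinj := IsFractionRing.injective R K
  refine isCoprime_of_irreducible_dvd (fun h ↦ (hg.map _).ne_zero h.1) fun z hz hz₁ hz₂ ↦ ?_
  obtain ⟨z', hz'⟩ := IsIntegrallyClosed.eq_map_mul_C_of_dvd K hg hz₁
  have hlc : z.leadingCoeff ≠ 0 := leadingCoeff_ne_zero.2 hz.ne_zero
  have hz'' : z'.map (algebraMap R K) = z * C z.leadingCoeff⁻¹ := by
    rw [← hz', mul_assoc, ← C_mul, hz', mul_inv_cancel₀ hlc, C_1, mul_one]
  have hassoc : Associated (z'.map (algebraMap R K)) z := by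
    rw [hz'']
    exact associated_mul_unit_left _ _ (isUnit_C.2 (inv_ne_zero hlc).isUnit)
  have hmon : z'.Monic := monic_of_injective hinj (by
    rw [hz'']
    exact monic_mul_leadingCoeff_inv hz.ne_zero)
  have h₁ : z' ∣ g := (map_dvd_map _ hinj hmon).1 (hassoc.dvd.trans hz₁)
  have h₂ : z' ∣ derivative g := (map_dvd_map _ hinj hmon).1 (by
    rw [← derivative_map]
    exact hassoc.dvd.trans hz₂)
  have hu : IsUnit (z'.map (IsLocalRing.residue R)) := by
    refine hsep.isUnit_of_dvd' (Polynomial.map_dvd _ h₁) ?_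
    rw [derivative_map]
    exact Polynomial.map_dvd _ h₂
  have h1 := (hmon.map (IsLocalRing.residue R)).eq_one_of_isUnit hu
  have hd : z'.natDegree = 0 := by
    rw [← hmon.natDegree_map (IsLocalRing.residue R), h1, natDegree_one]
  have : z' = 1 := hmon.natDegree_eq_zero.1 hd
  rw [this, Polynomial.map_one] at hassoc
  exact hz.not_isUnit (hassoc.isUnit isUnit_one)

namespace AddVal

open Polynomial IsLocalRing

variable {F Ω : Type*} [Field F] [Field Ω] [Algebra F Ω] {V : AddVal Ω}

lemma IsNormalizedOn.exists_abs_eq (hnorm : V.IsNormalizedOn F) :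
    ∃ ϖ : F, V.abs (algebraMap F Ω ϖ) = Real.exp (-1) := by
  obtain ⟨ϖ, hϖ⟩ := hnorm.2
  exact ⟨ϖ, (V.v_eq_coe_iff _ _).1 hϖ⟩

section Conjugates

variable [IsSepClosure F Ω]

/-- The valuation of a Henselian field extends Galois invariantly to the separable closure. -/
theorem IsHenselianOn.abs_algEquiv_apply (hnorm : V.IsNormalizedOn F)
    (hhens : V.IsHenselianOn F) (γ : Ω ≃ₐ[F] Ω) (x : Ω) : V.abs (γ x) = V.abs x := by
  obtain ⟨ϖ, hϖ⟩ := hnorm.exists_abs_eq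
  let N : IntermediateField F Ω :=
    IntermediateField.normalClosure F (IntermediateField.adjoin F {x}) Ω
  have hfin : FiniteDimensional F (IntermediateField.adjoin F {x}) :=
    IntermediateField.adjoin.finiteDimensional (Algebra.IsIntegral.isIntegral x)
  have hN : FiniteDimensional F N := inferInstance
  have hNorm : Normal F N := inferInstance
  have hGal : IsGalois F N := IsGalois.mk
  have hxN : x ∈ N :=
    IntermediateField.le_normalClosure _ (IntermediateField.mem_adjoin_simple_self F x)
  let A : AbsoluteValue N ℝ := V.abs.comp (f := algebraMap N Ω) (algebraMap N Ω).injective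
  have h := abs_algEquiv_apply_of_hensel (F := F) (A := A)
    (fun a b ↦ V.isNonarchimedean_abs (a : Ω) (b : Ω)) (ϖ := ϖ)
    (show 0 < V.abs (algebraMap F Ω ϖ) by rw [hϖ]; exact Real.exp_pos _)
    (show V.abs (algebraMap F Ω ϖ) < 1 by rw [hϖ]; simp)
    (fun f h₁ h₂ h₃ ↦ by
      obtain ⟨a, ha, -⟩ := hhens f (fun i ↦ (V.v_nonneg_iff _).2 (h₁ i)) 1
        ((V.v_nonneg_iff _).2 (by rw [map_one, ← abs_apply, map_one]))
        ((V.v_pos_iff _).2 h₂) ((V.v_eq_zero_iff _).2 h₃)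
      exact ⟨a, ha⟩)
    (γ.restrictNormal N) ⟨x, hxN⟩
  have hγ := γ.restrictNormal_commutes N ⟨x, hxN⟩
  change V.abs (algebraMap N Ω _) = V.abs x at h
  rw [hγ] at h
  exact h

lemma IsHenselianOn.abs_algHom_apply (hnorm : V.IsNormalizedOn F)
    (hhens : V.IsHenselianOn F) {E : IntermediateField F Ω} (σ : E →ₐ[F] Ω) (x : E) :
    V.abs (σ x) = V.abs (x : Ω) := by
  have h : IsConjRoot F (σ x) (x : Ω) :=
    (minpoly.algHom_eq σ σ.injective x).trans (minpoly.algHom_eq E.val E.val.injective x).symm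
  obtain ⟨γ, hγ⟩ := h.exists_algEquiv
  rw [← hγ, hhens.abs_algEquiv_apply hnorm]

end Conjugates

section ResidueField

variable (V) (F)

/-- The valuation ring of the base field. -/
def baseRing : ValuationSubring F := V.valRing.comap (algebraMap F Ω)

/-- The inclusion of the valuation ring of the base field. -/
def baseHom : V.baseRing F →+* V.valRing :=
  ((algebraMap F Ω).comp (V.baseRing F).subtype).codRestrict V.valRing fun x ↦ x.2

lemma coe_baseHom (x : V.baseRing F) : (V.baseHom F x : Ω) = algebraMap F Ω x := rfl

lemma subtype_comp_baseHom :
    V.valRing.subtype.comp (V.baseHom F) = (algebraMap F Ω).comp (V.baseRing F).subtype := rfl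

instance isLocalHom_baseHom : IsLocalHom (V.baseHom F) where
  map_nonunit x hx := by
    obtain ⟨y, hy⟩ := hx.exists_right_inv
    have hy' : algebraMap F Ω x * (y : Ω) = 1 := congrArg Subtype.val hy
    have hx0 : (x : F) ≠ 0 := fun h ↦ by simp [h] at hy'
    have hmem : (x : F)⁻¹ ∈ V.baseRing F := by
      change algebraMap F Ω (x : F)⁻¹ ∈ V.valRing
      rw [map_inv₀, inv_eq_of_mul_eq_one_right hy']
      exact y.2
    exact IsUnit.of_mul_eq_one ⟨(x : F)⁻¹, hmem⟩ (Subtype.ext (mul_inv_cancel₀ hx0))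

lemma residue_baseRing_eq_zero_iff (x : V.baseRing F) :
    residue (V.baseRing F) x = 0 ↔ V.abs (algebraMap F Ω x) < 1 := by
  rw [← coe_baseHom, ← residue_eq_zero_iff, ← ResidueField.map_residue,
    map_eq_zero_iff (ResidueField.map (V.baseHom F)) (RingHom.injective _)]

variable {V} {F}

lemma HasPerfectResidueFieldOn.perfectField (hperf : V.HasPerfectResidueFieldOn F) :
    PerfectField (ResidueField (V.baseRing F)) := by
  obtain ⟨p, hp⟩ := CharP.exists (ResidueField (V.baseRing F))
  rcases CharP.char_is_prime_or_zero (ResidueField (V.baseRing F)) p with hprime | rfl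
  · have := Fact.mk hprime
    have hp0 : 0 < V.v (algebraMap F Ω (p : F)) := by
      have h : residue (V.baseRing F) (p : V.baseRing F) = 0 := by
        rw [map_natCast, CharP.cast_eq_zero]
      rw [residue_baseRing_eq_zero_iff] at h
      exact (V.v_pos_iff _).2 (by simpa [abs_apply] using h)
    have hsurj : Function.Surjective (frobenius (ResidueField (V.baseRing F)) p) := fun z ↦ by
      obtain ⟨x, rfl⟩ := residue_surjective z
      obtain ⟨y, hy, hxy⟩ := hperf p hprime hp0 x ((V.v_nonneg_iff _).2 x.2)
      refine ⟨residue _ ⟨y, (V.v_nonneg_iff _).1 hy⟩, ?_⟩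
      rw [frobenius_def, ← map_pow, eq_comm, ← sub_eq_zero, ← map_sub,
        residue_baseRing_eq_zero_iff]
      exact (V.v_pos_iff _).1 hxy
    have := PerfectRing.ofSurjective _ p hsurj
    exact PerfectRing.toPerfectField _ p
  · have := CharP.charP_to_charZero (ResidueField (V.baseRing F))
    infer_instance

variable [IsSepClosure F Ω]

lemma IsHenselianOn.exists_monic_root (hnorm : V.IsNormalizedOn F) (hhens : V.IsHenselianOn F)
    (x : V.valRing) : ∃ p : (V.baseRing F)[X], p.Monic ∧ p.eval₂ (V.baseHom F) x = 0 := by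
  have hint : IsIntegral F (x : Ω) := Algebra.IsIntegral.isIntegral _
  have hsplit : (minpoly F (x : Ω)).map (algebraMap F Ω) =
      (((minpoly F (x : Ω)).aroots Ω).map fun a ↦ X - C a).prod :=
    (Normal.splits inferInstance _).eq_prod_roots_of_monic ((minpoly.monic hint).map _)
  have hcoeff := V.isNonarchimedean_abs.prod_X_sub_C_integral ((minpoly F (x : Ω)).aroots Ω)
    fun a ha ↦ by
      obtain ⟨γ, rfl⟩ := minpoly.exists_algEquiv_of_root' (K := F) hint.isAlgebraic
        (mem_aroots.1 ha).2
      rw [hhens.abs_algEquiv_apply hnorm]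
      exact x.2
  have hlift : minpoly F (x : Ω) ∈ lifts (V.baseRing F).subtype := by
    rw [lifts_iff_coeff_lifts]
    intro i
    refine ⟨⟨(minpoly F (x : Ω)).coeff i, ?_⟩, rfl⟩
    change V.abs (algebraMap F Ω _) ≤ 1
    rw [← coeff_map, hsplit]
    exact hcoeff.1 i
  obtain ⟨p, hp, -, hmon⟩ := lifts_and_natDegree_eq_and_monic hlift (minpoly.monic hint)
  refine ⟨p, hmon, Subtype.ext ?_⟩
  change V.valRing.subtype _ = _
  rw [hom_eval₂, subtype_comp_baseHom, ← eval₂_map, hp]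
  exact minpoly.aeval F (x : Ω)

/-- Distinct integral roots of a monic polynomial with separable reduction are
incongruent modulo the maximal ideal. -/
lemma eq_of_residue_eq_of_separable {R : Type*} [CommRing R] [IsDomain R] [IsLocalRing R]
    {G : R[X]} (hsep : (G.map (residue R)).Separable) {a b : R} (ha : G.eval a = 0)
    (hb : G.eval b = 0) (hab : residue R a = residue R b) : a = b := by
  by_contra hne
  obtain ⟨k, hk⟩ := G.binomExpansion a (b - a)
  rw [add_sub_cancel, ha, hb, zero_add, sq, ← mul_assoc, ← add_mul, eq_comm] at hk
  have hsub : b - a ≠ 0 := sub_ne_zero.2 (Ne.symm hne)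
  have h0 := (mul_eq_zero.1 hk).resolve_right hsub
  have h1 := congrArg (residue R) h0
  rw [map_add, map_mul, map_sub, hab, sub_self, mul_zero, add_zero, map_zero] at h1
  have h2 : (G.map (residue R)).aeval (residue R a) = 0 := by
    rw [coe_aeval_eq_eval, eval_map, eval₂_hom, ha, map_zero]
  refine hsep.aeval_derivative_ne_zero h2 ?_
  rw [coe_aeval_eq_eval, derivative_map, eval_map, eval₂_hom, h1]

/-- Every integral element is congruent to a root of a polynomial over the base field whose roots
are pairwise incongruent. -/
theorem exists_root_abs_sub_lt_one (hnorm : V.IsNormalizedOn F) (hhens : V.IsHenselianOn F)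
    (hperf : V.HasPerfectResidueFieldOn F) {x : Ω} (hx : V.abs x ≤ 1) :
    ∃ (f : F[X]) (a : Ω), aeval a f = 0 ∧ V.abs (x - a) < 1 ∧
      ∀ b c : Ω, aeval b f = 0 → aeval c f = 0 → V.abs (b - c) < 1 → b = c := by
  let ψ := ResidueField.map (V.baseHom F)
  let := ψ.toAlgebra
  have hperf' := hperf.perfectField
  let x' : V.valRing := ⟨x, hx⟩
  have hint : IsIntegral (ResidueField (V.baseRing F)) (residue V.valRing x') := by
    obtain ⟨p, hp, hpx⟩ := hhens.exists_monic_root hnorm x'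
    refine ⟨p.map (residue _), hp.map _, ?_⟩
    have h := congrArg (residue V.valRing) hpx
    rw [hom_eval₂, map_zero] at h
    rw [eval₂_map]
    exact h
  have hsep := PerfectField.separable_of_irreducible (minpoly.irreducible hint)
  have hlift : minpoly (ResidueField (V.baseRing F)) (residue V.valRing x') ∈
      lifts (residue (V.baseRing F)) := by
    rw [lifts_iff_coeff_lifts]
    exact fun i ↦ residue_surjective _
  obtain ⟨g, hg, -, hmon⟩ := lifts_and_natDegree_eq_and_monic hlift (minpoly.monic hint)
  set G := g.map (V.baseHom F) with hG
  have hGres : G.map (residue V.valRing) = (g.map (residue (V.baseRing F))).map ψ := by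
    rw [hG, Polynomial.map_map, Polynomial.map_map]
    rfl
  have hGsep : (G.map (residue V.valRing)).Separable := by
    rw [hGres, hg]
    exact hsep.map
  have hval : ∀ b : V.valRing,
      ((G.eval b : V.valRing) : Ω) = aeval (b : Ω) (g.map (V.baseRing F).subtype) := fun b ↦ by
    change V.valRing.subtype _ = _
    rw [hG, eval_map, hom_eval₂, subtype_comp_baseHom, aeval_def, eval₂_map]
    rfl
  have hroot : ∀ b : Ω, aeval b (g.map (V.baseRing F).subtype) = 0 →
      ∃ b' : V.valRing, (b' : Ω) = b ∧ G.eval b' = 0 := fun b hb ↦ by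
    have hbint : IsIntegral V.valRing b := by
      refine ⟨G, hmon.map _, ?_⟩
      rw [hG, eval₂_map]
      rw [aeval_def, eval₂_map] at hb
      exact hb
    obtain ⟨b', rfl⟩ := IsIntegrallyClosed.isIntegral_iff.1 hbint
    refine ⟨b', rfl, Subtype.ext ?_⟩
    rw [hval]
    exact hb
  have hfsep : (g.map (V.baseRing F).subtype).Separable :=
    hmon.separable_map_of_residue (K := F) (hg ▸ hsep)
  have := IsSepClosure.sep_closed (k := F) (K := Ω)
  have hsplit : ((g.map (V.baseRing F).subtype).map (algebraMap F Ω)) =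
      (((g.map (V.baseRing F).subtype).aroots Ω).map fun a ↦ X - C a).prod :=
    (IsSepClosed.splits_codomain _ hfsep).eq_prod_roots_of_monic ((hmon.map _).map _)
  have hlt : V.abs (aeval x (g.map (V.baseRing F).subtype)) < 1 := by
    have h := hval x'
    change _ = aeval x _ at h
    rw [← h, ← residue_eq_zero_iff, ← eval₂_hom, ← eval_map, hGres, hg, eval_map]
    exact minpoly.aeval _ _
  obtain ⟨z, hz, hzlt⟩ := exists_abs_lt_one_of_multiset_prod (V := V)
    (((g.map (V.baseRing F).subtype).aroots Ω).map fun a ↦ x - a) (by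
      rw [← eval_map_algebraMap, hsplit, eval_multiset_prod, Multiset.map_map] at hlt
      simpa [Function.comp_def] using hlt)
  obtain ⟨a, ha, rfl⟩ := Multiset.mem_map.1 hz
  refine ⟨g.map (V.baseRing F).subtype, a, (mem_aroots.1 ha).2, hzlt, fun b c hb hc hbc ↦ ?_⟩
  obtain ⟨b, rfl, hb'⟩ := hroot b hb
  obtain ⟨c, rfl, hc'⟩ := hroot c hc
  refine congrArg Subtype.val (eq_of_residue_eq_of_separable hGsep hb' hc' ?_)
  rw [← sub_eq_zero, ← map_sub, residue_eq_zero_iff]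
  exact hbc

/-- Every integral element of an intermediate field is congruent to an element of that field
on which any two embeddings congruent modulo the maximal ideal agree. -/
theorem exists_mem_abs_sub_lt_one (hnorm : V.IsNormalizedOn F) (hhens : V.IsHenselianOn F)
    (hperf : V.HasPerfectResidueFieldOn F) (U : IntermediateField F Ω) {x : Ω} (hxU : x ∈ U)
    (hx : V.abs x ≤ 1) :
    ∃ a : U, V.abs (a : Ω) ≤ 1 ∧ V.abs (x - a) < 1 ∧
      ∀ σ τ : U →ₐ[F] Ω, V.abs (σ a - τ a) < 1 → σ a = τ a := by
  obtain ⟨f, a, ha, hxa, hf⟩ := exists_root_abs_sub_lt_one hnorm hhens hperf hx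
  suffices h : a ∈ U by
    have haint := V.abs_sub_le_max x (x - a)
    rw [sub_sub_cancel] at haint
    have hroot : aeval (⟨a, h⟩ : U) f = 0 := by
      refine U.val.injective (?_ : U.val (aeval _ f) = U.val 0)
      rw [← aeval_algHom_apply, map_zero]
      exact ha
    have hroot' : ∀ σ : U →ₐ[F] Ω, aeval (σ ⟨a, h⟩) f = 0 := fun σ ↦ by
      rw [aeval_algHom_apply, hroot, map_zero]
    exact ⟨⟨a, h⟩, haint.trans (max_le hx hxa.le), hxa,
      fun σ τ hστ ↦ hf _ _ (hroot' σ) (hroot' τ) hστ⟩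
  have hgal : IsGalois U Ω := inferInstance
  have hbot : a ∈ (⊥ : IntermediateField U Ω) := by
    rw [InfiniteGalois.mem_bot_iff_fixed]
    intro γ
    refine hf _ _ ?_ ha ?_
    · rw [← AlgEquiv.restrictScalars_apply F, ← AlgEquiv.coe_toAlgHom, aeval_algHom_apply, ha,
        map_zero]
    · have hγx : γ x = x := γ.commutes ⟨x, hxU⟩
      have h := hhens.abs_algEquiv_apply hnorm (γ.restrictScalars F) (a - x)
      rw [AlgEquiv.restrictScalars_apply, map_sub, hγx] at h
      refine V.abs_sub_lt (y := x) ?_ hxa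
      rw [h, abs_sub_comm]
      exact hxa
  obtain ⟨u, rfl⟩ := IntermediateField.mem_bot.1 hbot
  exact u.2

end ResidueField

section Ramification

lemma xiRel_iff {E : IntermediateField F Ω} {e : ℕ} {r : ℝ} {σ τ : E →ₐ[F] Ω} :
    xiRel V E e r σ τ ↔
      ∀ x : E, V.abs (x : Ω) ≤ 1 → V.abs (σ x - τ x) ≤ Real.exp (-((r + 1) / e)) := by
  simp only [xiRel, v_nonneg_iff, coe_le_v_iff, abs_apply]

lemma abs_sub_lt_one_of_xiRel {E : IntermediateField F Ω} {e : ℕ} (he : 0 < e) {r : ℝ}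
    (hr : -1 < r) {σ τ : E →ₐ[F] Ω} (h : xiRel V E e r σ τ) {x : E} (hx : V.abs (x : Ω) ≤ 1) :
    V.abs (σ x - τ x) < 1 := by
  refine (xiRel_iff.1 h x hx).trans_lt (Real.exp_lt_one_iff.2 ?_)
  have : 0 < (r + 1) / e := div_pos (by linarith) (by exact_mod_cast he)
  linarith

lemma exp_neg_div_eq (e n : ℕ) : Real.exp (-((n : ℝ) / e)) = Real.exp (-(1 / e)) ^ n := by
  rw [← Real.exp_nat_mul]
  congr 1
  ring

lemma IsRamIdx.exists_abs_eq {E : IntermediateField F Ω} {e : ℕ} (he : V.IsRamIdx E e) :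
    ∃ ϖ : E, V.abs (ϖ : Ω) = Real.exp (-(1 / e)) := by
  obtain ⟨ϖ, hϖ⟩ := he.2.2
  exact ⟨ϖ, (V.v_eq_coe_iff _ _).1 hϖ⟩

lemma IsRamIdx.abs_le_pow_succ {E : IntermediateField F Ω} {e : ℕ} (he : V.IsRamIdx E e)
    {n : ℕ} {x : E} (hx : V.abs (x : Ω) < Real.exp (-(1 / e)) ^ n) :
    V.abs (x : Ω) ≤ Real.exp (-(1 / e)) ^ (n + 1) := by
  rcases eq_or_ne x 0 with rfl | hx0
  · rw [ZeroMemClass.coe_zero, map_zero]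
    positivity
  obtain ⟨k, hk⟩ := he.2.1 x hx0
  have he0 : (0 : ℝ) < e := by exact_mod_cast he.1
  rw [v_eq_coe_iff, ← abs_apply] at hk
  rw [← exp_neg_div_eq, hk, Real.exp_lt_exp, neg_lt_neg_iff, div_lt_div_iff_of_pos_right he0] at hx
  rw [← exp_neg_div_eq, hk, Real.exp_le_exp, neg_le_neg_iff, div_le_div_iff_of_pos_right he0]
  have : (n : ℤ) < k := by exact_mod_cast hx
  exact_mod_cast this

/-- A subextension of a finitely ramified extension is finitely ramified. -/
lemma IsRamIdx.exists_of_le (hnorm : V.IsNormalizedOn F) {E U : IntermediateField F Ω} {e : ℕ}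
    (he : V.IsRamIdx E e) (hUE : U ≤ E) : ∃ eU : ℕ, V.IsRamIdx U eU := by
  have he0 : (e : ℝ) ≠ 0 := by exact_mod_cast he.1.ne'
  let H : AddSubgroup ℤ :=
    { carrier := {k | ∃ x : U, V.abs (x : Ω) = Real.exp (-((k : ℝ) / e))}
      zero_mem' := ⟨1, by simp⟩
      add_mem' := by
        rintro k l ⟨x, hx⟩ ⟨y, hy⟩
        refine ⟨x * y, ?_⟩
        rw [IntermediateField.coe_mul, map_mul, hx, hy, ← Real.exp_add]
        congr 1
        push_cast
        ring
      neg_mem' := by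
        rintro k ⟨x, hx⟩
        refine ⟨x⁻¹, ?_⟩
        rw [IntermediateField.coe_inv, map_inv₀, hx, ← Real.exp_neg]
        congr 1
        push_cast
        ring }
  have heH : (e : ℤ) ∈ H := by
    obtain ⟨ϖ, hϖ⟩ := hnorm.exists_abs_eq
    refine ⟨algebraMap F U ϖ, ?_⟩
    rw [Int.cast_natCast, div_self he0]
    exact hϖ
  obtain ⟨d, hd⟩ := Int.subgroup_cyclic H
  rw [← AddSubgroup.zmultiples_eq_closure] at hd
  have hd' : ∀ {k : ℤ}, k ∈ H ↔ (d.natAbs : ℤ) ∣ k := fun {k} ↦ by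
    rw [hd, Int.mem_zmultiples_iff, Int.natAbs_dvd]
  obtain ⟨m, hm⟩ := Int.natCast_dvd_natCast.1 (hd'.1 heH)
  have hm0 : 0 < m := Nat.pos_of_ne_zero fun h ↦ he.1.ne' (by rw [hm, h, mul_zero])
  have hd0 : (d.natAbs : ℝ) ≠ 0 := by
    intro h
    apply he0
    rw [hm, Nat.cast_mul, h, zero_mul]
  have hm0' : (m : ℝ) ≠ 0 := by exact_mod_cast hm0.ne'
  have hscale : ∀ j : ℤ, (((d.natAbs : ℤ) * j : ℤ) : ℝ) / e = j / m := fun j ↦ by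
    rw [hm, Int.cast_mul, Int.cast_natCast, Nat.cast_mul]
    exact mul_div_mul_left _ _ hd0
  refine ⟨m, hm0, fun x hx ↦ ?_, ?_⟩
  · obtain ⟨k, hk⟩ := he.2.1 ⟨x, hUE x.2⟩ fun h ↦
      hx (Subtype.ext (congrArg (Subtype.val : E → Ω) h))
    obtain ⟨j, rfl⟩ := hd'.1 (show k ∈ H from ⟨x, (V.v_eq_coe_iff _ _).1 hk⟩)
    exact ⟨j, by rw [← hscale]; exact hk⟩
  · obtain ⟨x, hx⟩ := hd'.2 (dvd_refl (d.natAbs : ℤ))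
    refine ⟨x, (V.v_eq_coe_iff _ _).2 ?_⟩
    rw [← abs_apply, hx]
    have := hscale 1
    rw [mul_one, Int.cast_one] at this
    rw [this]

variable [IsSepClosure F Ω]

/-- Embeddings that are congruent modulo the maximal ideal are `Ξ_0`-equivalent. -/
theorem xiRel_zero_of_abs_sub_lt_one (hnorm : V.IsNormalizedOn F) (hhens : V.IsHenselianOn F)
    (hperf : V.HasPerfectResidueFieldOn F) {U : IntermediateField F Ω} {e : ℕ}
    (he : V.IsRamIdx U e) {σ τ : U →ₐ[F] Ω}
    (h : ∀ x : U, V.abs (x : Ω) ≤ 1 → V.abs (σ x - τ x) < 1) : xiRel V U e 0 σ τ := by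
  refine xiRel_iff.2 fun x hx ↦ ?_
  obtain ⟨a, haint, hxa, hf⟩ := exists_mem_abs_sub_lt_one hnorm hhens hperf U x.2 hx
  have heq : σ a = τ a := hf _ _ (h a haint)
  have hsub : σ x - τ x = σ (x - a) - τ (x - a) := by
    rw [map_sub, map_sub, heq]
    ring
  rw [hsub]
  refine (V.abs_sub_le_max _ _).trans ?_
  rw [hhens.abs_algHom_apply hnorm, hhens.abs_algHom_apply hnorm, max_self]
  have := he.abs_le_pow_succ (n := 0) (x := x - a) (by simpa using hxa)
  simpa using this

/-- Embeddings congruent to the inclusion modulo the maximal ideal are determined, even linearly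
independently, by their values on the powers of a uniformizer below the ramification index. -/
theorem linearIndependent_apply_uniformizer_pow (hnorm : V.IsNormalizedOn F)
    (hhens : V.IsHenselianOn F) (hperf : V.HasPerfectResidueFieldOn F)
    {E : IntermediateField F Ω} {e : ℕ} (he : V.IsRamIdx E e)
    {S : Set (E →ₐ[F] Ω)}
    (hS : ∀ σ ∈ S, ∀ x : E, V.abs (x : Ω) ≤ 1 → V.abs (σ x - x) < 1)
    {π : E} (hπ : V.abs (π : Ω) = Real.exp (-(1 / e))) :
    LinearIndependent Ω fun (σ : S) (i : Fin e) ↦ (σ : E →ₐ[F] Ω) (π ^ (i : ℕ)) := by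
  rw [linearIndependent_iff']
  intro s l hl
  set q := Real.exp (-(1 / (e : ℝ))) with hq
  have he0 : (e : ℝ) ≠ 0 := by exact_mod_cast he.1.ne'
  have hq0 : 0 < q := Real.exp_pos _
  have hq1 : q < 1 := Real.exp_lt_one_iff.2 (by
    have : (0 : ℝ) < 1 / e := div_pos one_pos (by exact_mod_cast he.1)
    linarith)
  obtain ⟨ϖ, hϖ⟩ := hnorm.exists_abs_eq
  have hϖq : V.abs (algebraMap F Ω ϖ) = q ^ e := by
    rw [hϖ, hq, ← exp_neg_div_eq, div_self he0]
  let φ : E →ₗ[F] Ω := ∑ σ ∈ s, l σ • (σ : E →ₐ[F] Ω).toLinearMap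
  have hφ : ∀ x, φ x = ∑ σ ∈ s, l σ * (σ : E →ₐ[F] Ω) x := fun x ↦ by
    simp [φ, LinearMap.sum_apply]
  have hφπ : ∀ i < e, φ (π ^ i) = 0 := fun i hi ↦ by
    have := congrFun hl ⟨i, hi⟩
    simpa [hφ] using this
  have hφmul : ∀ a : E, (∀ σ ∈ S, σ a = a) → ∀ y, φ (a * y) = a * φ y := fun a ha y ↦ by
    rw [hφ, hφ, Finset.mul_sum]
    refine Finset.sum_congr rfl fun σ _ ↦ ?_
    rw [map_mul, ha σ σ.2]
    ring
  have hbound : ∀ y : E, V.abs (φ y) ≤ (∑ σ ∈ s, V.abs (l σ)) * V.abs (y : Ω) := fun y ↦ by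
    rw [hφ, Finset.sum_mul]
    refine (V.abs.sum_le _ _).trans (Finset.sum_le_sum fun σ _ ↦ ?_)
    rw [map_mul, hhens.abs_algHom_apply hnorm]
  have happrox : ∀ x : E, V.abs (x : Ω) ≤ 1 → ∀ n : ℕ,
      ∃ y : E, V.abs (y : Ω) ≤ q ^ n ∧ φ y = φ x := fun x hx n ↦ by
    induction n with
    | zero => exact ⟨x, by simpa using hx, rfl⟩
    | succ n ih =>
      obtain ⟨y, hy, hyx⟩ := ih
      let p : E := π ^ (n % e) * algebraMap F E (ϖ ^ (n / e))
      have hp : V.abs (p : Ω) = q ^ n := by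
        have : (p : Ω) = (π : Ω) ^ (n % e) * algebraMap F Ω ϖ ^ (n / e) := by
          simp only [p, IntermediateField.coe_mul, IntermediateField.coe_pow, map_pow]
          rfl
        rw [this, map_mul, map_pow, map_pow, hπ, hϖq, ← pow_mul, ← pow_add, Nat.mod_add_div]
      have hp0 : (p : Ω) ≠ 0 := fun h ↦ by
        rw [h, map_zero] at hp
        exact (pow_pos hq0 n).ne hp
      have hyp : V.abs ((y / p : E) : Ω) ≤ 1 := by
        rw [IntermediateField.coe_div, map_div₀, hp]
        exact div_le_one_of_le₀ hy (pow_pos hq0 n).le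
      obtain ⟨a, haint, hya, hf⟩ := exists_mem_abs_sub_lt_one hnorm hhens hperf E (y / p).2 hyp
      have hafix : ∀ σ ∈ S, σ a = a := fun σ hσ ↦ hf σ E.val (hS σ hσ a haint)
      have hφp : φ p = 0 := by
        rw [show p = algebraMap F E (ϖ ^ (n / e)) * π ^ (n % e) from mul_comm _ _,
          ← Algebra.smul_def, map_smul, hφπ _ (Nat.mod_lt _ he.1), smul_zero]
      refine ⟨y - a * p, he.abs_le_pow_succ ?_, ?_⟩
      · have : ((y - a * p : E) : Ω) = (((y / p : E) : Ω) - a) * p := by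
          rw [AddSubgroupClass.coe_sub, IntermediateField.coe_mul, IntermediateField.coe_div,
            sub_mul, div_mul_cancel₀ _ hp0]
        rw [this, map_mul, hp]
        exact mul_lt_of_lt_one_left (pow_pos hq0 n) hya
      · rw [map_sub, hφmul a hafix, hφp, mul_zero, sub_zero, hyx]
  have hφint : ∀ x : E, V.abs (x : Ω) ≤ 1 → φ x = 0 := fun x hx ↦ by
    rw [← V.abs.eq_zero]
    refine le_antisymm ?_ (V.abs.nonneg _)
    have hlim : Filter.Tendsto (fun n : ℕ ↦ (∑ σ ∈ s, V.abs (l σ)) * q ^ n) Filter.atTop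
        (nhds 0) := by
      simpa using (tendsto_pow_atTop_nhds_zero_of_lt_one hq0.le hq1).const_mul
        (∑ σ ∈ s, V.abs (l σ))
    refine ge_of_tendsto' hlim fun n ↦ ?_
    obtain ⟨y, hy, hyx⟩ := happrox x hx n
    rw [← hyx]
    exact (hbound y).trans
      (mul_le_mul_of_nonneg_left hy (Finset.sum_nonneg fun _ _ ↦ V.abs.nonneg _))
  have hφ0 : ∀ x, φ x = 0 := fun x ↦ by
    have hϖ1 : q ^ e < 1 := pow_lt_one₀ hq0.le hq1 he.1.ne'
    obtain ⟨m, hm⟩ := exists_pow_lt_of_lt_one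
      (inv_pos.2 (add_pos_of_nonneg_of_pos (V.abs.nonneg (x : Ω)) one_pos)) hϖ1
    have hx1 : V.abs ((ϖ ^ m • x : E) : Ω) ≤ 1 := by
      rw [IntermediateField.coe_smul, Algebra.smul_def, map_mul, map_pow, map_pow, hϖq]
      have hpos := add_pos_of_nonneg_of_pos (V.abs.nonneg (x : Ω)) one_pos
      calc (q ^ e) ^ m * V.abs (x : Ω) ≤ (V.abs (x : Ω) + 1)⁻¹ * (V.abs (x : Ω) + 1) := by
            gcongr
            linarith
        _ = 1 := inv_mul_cancel₀ hpos.ne'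
    have h := hφint _ hx1
    have hϖ0 : ϖ ≠ 0 := fun h ↦ by
      rw [h, map_zero, map_zero] at hϖq
      exact (pow_pos hq0 e).ne hϖq
    rw [map_smul] at h
    exact (smul_eq_zero.1 h).resolve_left (pow_ne_zero m hϖ0)
  have hded : LinearIndependent Ω fun σ : S ↦ ((σ : E →ₐ[F] Ω) : E → Ω) :=
    (linearIndependent_monoidHom E Ω).comp (fun σ : S ↦ ((σ : E →ₐ[F] Ω) : E →* Ω))
      fun σ τ h ↦ Subtype.ext (AlgHom.ext fun x ↦ DFunLike.congr_fun h x)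
  refine linearIndependent_iff'.1 hded s l (funext fun x ↦ ?_)
  have := hφ0 x
  rw [hφ] at this
  simpa using this

end Ramification

end AddVal

/-- If `r > -1` and `σ, τ : E → F^sep` are `Ξ_r`-equivalent `F`-algebra
embeddings, then `σ` and `τ` agree on the maximal unramified subextension of `E/F`
(= the compositum of all unramified subextensions of `E/F`).  Consequently, for every
`r > -1`, the common cardinality `g_r` of the `Ξ_r`-classes satisfies `1 ≤ g_r ≤ e(E/F)`. -/
theorem xiRel_agree_on_max_unramified_and_g_bounds
    {F Ω : Type*} [Field F] [Field Ω] [Algebra F Ω] [IsSepClosure F Ω]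
    (V : AddVal Ω) (hnorm : V.IsNormalizedOn F) (hhens : V.IsHenselianOn F)
    (hperf : V.HasPerfectResidueFieldOn F)
    (E : IntermediateField F Ω) (e : ℕ) (he : V.IsRamIdx E e)
    (r : ℝ) (hr : -1 < r) :
    (∀ σ τ : ↥E →ₐ[F] Ω, xiRel V E e r σ τ →
      ∀ x : ↥E,
        (∃ U : IntermediateField F Ω, U ≤ E ∧ (x : Ω) ∈ U ∧ IsUnramifiedSubext V U) →
        σ x = τ x) ∧
    (1 ≤ gfun V E e r ∧ gfun V E e r ≤ e) := by
  refine ⟨?_, ?_⟩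
  · rintro σ τ hστ x ⟨U, hUE, hxU, hU⟩
    obtain ⟨eU, heU⟩ := he.exists_of_le hnorm hUE
    have h := hU eU heU (σ.comp (IntermediateField.inclusion hUE))
      (τ.comp (IntermediateField.inclusion hUE))
      (AddVal.xiRel_zero_of_abs_sub_lt_one hnorm hhens hperf heU fun y hy ↦
        AddVal.abs_sub_lt_one_of_xiRel he.1 hr hστ (x := IntermediateField.inclusion hUE y) hy)
    exact DFunLike.congr_fun h ⟨(x : Ω), hxU⟩
  · obtain ⟨π, hπ⟩ := he.exists_abs_eq
    have hli := AddVal.linearIndependent_apply_uniformizer_pow hnorm hhens hperf he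
      (S := {σ | xiRel V E e r σ E.val})
      (fun σ hσ x hx ↦ AddVal.abs_sub_lt_one_of_xiRel he.1 hr hσ hx) hπ
    have hfin : Finite {σ : E →ₐ[F] Ω // xiRel V E e r σ E.val} := hli.finite
    have hne : Nonempty {σ : E →ₐ[F] Ω // xiRel V E e r σ E.val} :=
      ⟨E.val, fun x _ ↦ by rw [sub_self, V.v_zero]; exact le_top⟩
    refine ⟨Nat.card_pos, ?_⟩
    have : Fintype {σ | xiRel V E e r σ E.val} := @Fintype.ofFinite _ hfin
    have hcard := hli.fintype_card_le_finrank
    rw [Module.finrank_fin_fun] at hcard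
    rwa [← Nat.card_eq_fintype_card] at hcard
end
end

section
/- Let F be a discretely valued Henselian field with perfect residue field and E/F a finitely ramified separable algebraic extension. If E∘/F is a subextension of E/F with e(E∘/F) = e(E/F), then for every r > −1 the value of g_r associated to E∘/F equals the value of g_r associated to E/F; consequently φ_{E/F} = φ_{E∘/F} and ψ_{E/F} = ψ_{E∘/F}. Moreover, there always exists a finite subextension E∘/F of E/F with e(E∘/F) = e(E/F). -/
noncomputable section

open scoped Classical

section HenselianUniqueness

open Polynomial NNReal

/-- The conclusion of the simple-root Hensel lemma, without control on the position of the root. -/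
def HasSimpleRootLifting {F : Type*} [Field F] (w : Valuation F ℝ≥0) : Prop :=
  ∀ f : F[X], (∀ i, w (f.coeff i) ≤ 1) → ∀ a₀ : F, w a₀ ≤ 1 → w (f.eval a₀) < 1 →
    w (f.derivative.eval a₀) = 1 → ∃ a : F, f.eval a = 0

variable {L : Type*} [Field L] (w : Valuation L ℝ≥0)

theorem exists_map_valuationSubring_eq {p : L[X]} (hp : ∀ i, w (p.coeff i) ≤ 1) :
    ∃ P : w.valuationSubring[X], P.map w.valuationSubring.subtype = p := by
  rw [← mem_lifts, lifts_iff_coeff_lifts]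
  exact fun n => ⟨⟨p.coeff n, hp n⟩, rfl⟩

theorem valuation_eval_le_one {p : L[X]} (hp : ∀ i, w (p.coeff i) ≤ 1) {a : L} (ha : w a ≤ 1) :
    w (p.eval a) ≤ 1 := by
  obtain ⟨P, rfl⟩ := exists_map_valuationSubring_eq w hp
  have := eval_map_apply w.valuationSubring.subtype (p := P) (⟨a, ha⟩ : w.valuationSubring)
  change eval a _ = _ at this
  rw [this]
  exact (P.eval ⟨a, ha⟩).2

theorem valuation_coeff_derivative_le_one {p : L[X]} (hp : ∀ i, w (p.coeff i) ≤ 1) (i : ℕ) :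
    w (p.derivative.coeff i) ≤ 1 := by
  obtain ⟨P, rfl⟩ := exists_map_valuationSubring_eq w hp
  rw [derivative_map, coeff_map]
  exact (P.derivative.coeff i).2

theorem valuation_coeff_prod_X_sub_C_le_one {s : Multiset L} (hs : ∀ r ∈ s, w r ≤ 1) (i : ℕ) :
    w ((s.map fun r => X - C r).prod.coeff i) ≤ 1 := by
  have : (s.map fun r => X - C r).prod ∈ lifts w.valuationSubring.subtype := by
    refine Subsemiring.multiset_prod_mem _ _ fun p hp => ?_
    obtain ⟨r, hr, rfl⟩ := Multiset.mem_map.1 hp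
    exact (mem_lifts _).2 ⟨X - C ⟨r, hs r hr⟩, by simp⟩
  obtain ⟨P, hP⟩ := (mem_lifts _).1 this
  rw [← hP, coeff_map]
  exact (P.coeff i).2

theorem valuation_eval_sub_eval_le {p : L[X]} (hp : ∀ i, w (p.coeff i) ≤ 1) {a b : L}
    (ha : w a ≤ 1) (hb : w b ≤ 1) : w (p.eval a - p.eval b) ≤ w (a - b) := by
  obtain ⟨P, rfl⟩ := exists_map_valuationSubring_eq w hp
  obtain ⟨c, hc⟩ := sub_dvd_eval_sub (⟨a, ha⟩ : w.valuationSubring) ⟨b, hb⟩ P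
  have := congrArg w.valuationSubring.subtype hc
  rw [map_sub, map_mul, map_sub, ← eval_map_apply, ← eval_map_apply] at this
  change eval a _ - eval b _ = (a - b) * c at this
  rw [this, map_mul]
  exact mul_le_of_le_one_right' c.2

/-- Two roots of an integral polynomial lying in the same residue class coincide if one of them is
a simple root modulo the maximal ideal. -/
theorem root_eq_of_valuation_sub_lt_one {p : L[X]} (hp : ∀ i, w (p.coeff i) ≤ 1) {a b : L}
    (ha : w a ≤ 1) (hb : w b ≤ 1) (hpa : p.eval a = 0) (hpb : p.eval b = 0)
    (hd : w (p.derivative.eval a) = 1) (hab : w (b - a) < 1) : b = a := by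
  obtain ⟨P, rfl⟩ := exists_map_valuationSubring_eq w hp
  obtain ⟨c, hc⟩ := binomExpansion P (⟨a, ha⟩ : w.valuationSubring) (⟨b, hb⟩ - ⟨a, ha⟩)
  rw [add_sub_cancel] at hc
  have := congrArg w.valuationSubring.subtype hc
  simp only [map_add, map_mul, map_sub, map_pow, ← eval_map_apply, ← derivative_map] at this
  change eval b _ = eval a _ + eval a _ * (b - a) + c * (b - a) ^ 2 at this
  rw [hpa, hpb, zero_add] at this
  by_contra hne
  have hne' : b - a ≠ 0 := sub_ne_zero.2 hne
  have h2 : eval a (derivative (map w.valuationSubring.subtype P)) = -(c * (b - a)) := by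
    apply mul_right_cancel₀ hne'
    linear_combination -this
  rw [h2, Valuation.map_neg, map_mul] at hd
  exact (mul_lt_one_of_nonneg_of_lt_one_right c.2 zero_le hab).ne hd

/-- The real absolute value attached to a valuation with values in `ℝ≥0`. -/
def Valuation.absoluteValue : AbsoluteValue L ℝ where
  toFun x := w x
  map_mul' x y := by simp
  nonneg' x := NNReal.coe_nonneg _
  eq_zero' x := by simp
  add_le' x y := by
    refine le_trans (NNReal.coe_le_coe.2 (w.map_add x y)) ?_
    rw [← NNReal.coe_add, NNReal.coe_le_coe]
    exact max_le_add_of_nonneg zero_le zero_le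

theorem Valuation.absoluteValue_apply (x : L) : w.absoluteValue x = w x := rfl

theorem Valuation.eq_of_absoluteValue_isEquiv {w₁ w₂ : Valuation L ℝ≥0} {π : L} (h0 : π ≠ 0)
    (h1 : w₁ π < 1) (h12 : w₁ π = w₂ π) (h : w₁.absoluteValue.IsEquiv w₂.absoluteValue) :
    w₁ = w₂ := by
  obtain ⟨c, hc, h⟩ := AbsoluteValue.isEquiv_iff_exists_rpow_eq.1 h
  have hx (x : L) : (w₁ x : ℝ) ^ c = w₂ x := congrFun h x
  have hc1 : c = 1 := by
    have := hx π
    rw [← h12] at this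
    nth_rw 2 [← Real.rpow_one (w₁ π : ℝ)] at this
    refine (Real.rpow_right_inj (NNReal.coe_pos.2 (pos_iff_ne_zero.2 (w₁.ne_zero_iff.2 h0)))
      ?_).1 this
    exact_mod_cast h1.ne
  ext x
  have := hx x
  rwa [hc1, Real.rpow_one] at this

variable {F : Type*} [Field F] [Algebra F L]

/-- An element of a finite Galois extension which is `≡ 1` modulo the maximal ideal of `w`, is
fixed by the stabilizer of `w`, and lies in the maximal ideals of all other conjugates of `w`. -/
theorem exists_separating_element [FiniteDimensional F L] {π : F} (hπ0 : π ≠ 0)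
    (hπ : w (algebraMap F L π) < 1) :
    ∃ β : L, w β = 1 ∧ w (β - 1) < 1 ∧ ∀ τ : L ≃ₐ[F] L,
      ((∀ x, w (τ x) = w x) ∧ τ β = β) ∨ ((∃ x, w (τ x) ≠ w x) ∧ w (τ β) < 1) := by
  have hπL : algebraMap F L π ≠ 0 := (_root_.map_ne_zero _).2 hπ0
  let u (τ : L ≃ₐ[F] L) : Valuation L ℝ≥0 := w.comap (τ : L →+* L)
  have hu (τ : L ≃ₐ[F] L) (x : L) : u τ x = w (τ x) := rfl
  have huπ (τ : L ≃ₐ[F] L) : u τ (algebraMap F L π) = w (algebraMap F L π) := by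
    rw [hu, AlgEquiv.commutes]
  let ι := Set.range u
  have : Finite ι := Set.finite_range u
  obtain ⟨a, ha, ha'⟩ := AbsoluteValue.exists_one_lt_lt_one_pi_of_not_isEquiv
    (v := fun i : ι => i.1.absoluteValue)
    (by
      rintro ⟨-, τ, rfl⟩
      refine ⟨algebraMap F L π, hπL, ?_⟩
      rw [Valuation.absoluteValue_apply, huπ]
      exact_mod_cast hπ.ne)
    (by
      rintro ⟨-, τ, rfl⟩ ⟨-, τ', rfl⟩ hne h
      exact hne (Subtype.ext (Valuation.eq_of_absoluteValue_isEquiv hπL ((huπ τ).trans_lt hπ)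
        ((huπ τ).trans (huπ τ').symm) h))) ⟨u 1, 1, rfl⟩
  replace ha : 1 < w a := by exact_mod_cast ha
  have ha0 : a ≠ 0 := by rintro rfl; simp at ha
  replace ha' (τ : L ≃ₐ[F] L) (hτ : ∃ x, w (τ x) ≠ w x) : w (τ a) < 1 := by
    have := ha' ⟨u τ, τ, rfl⟩ (by
      obtain ⟨x, hx⟩ := hτ
      intro h
      exact hx (DFunLike.congr_fun (Subtype.ext_iff.1 h) x))
    exact_mod_cast this
  let H : Subgroup (L ≃ₐ[F] L) :=
    { carrier := {τ | ∀ x, w (τ x) = w x}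
      mul_mem' := fun {σ τ} hσ hτ x => (hσ (τ x)).trans (hτ x)
      one_mem' := fun x => rfl
      inv_mem' := fun {τ} hτ x => by
        conv_rhs => rw [← AlgEquiv.apply_symm_apply τ x]
        exact (hτ _).symm }
  have hH (τ : L ≃ₐ[F] L) : τ ∈ H ↔ ∀ x, w (τ x) = w x := Iff.rfl
  let b : L := ∏ h : H, h.1 a
  have hb : 1 < w b := by
    rw [map_prod, Finset.prod_congr rfl fun (h : H) _ => h.2 a, Finset.prod_const]
    exact one_lt_pow₀ ha (Finset.card_pos.2 ⟨1, Finset.mem_univ _⟩).ne'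
  have hbH (τ : L ≃ₐ[F] L) (hτ : τ ∈ H) : τ b = b := by
    rw [map_prod]
    exact Fintype.prod_equiv (Equiv.mulLeft (⟨τ, hτ⟩ : H)) _ _ fun h => rfl
  have hb' (τ : L ≃ₐ[F] L) (hτ : τ ∉ H) : w (τ b) < 1 := by
    rw [map_prod, map_prod, ← Finset.prod_const_one (ι := H) (s := Finset.univ)]
    refine Finset.prod_lt_prod_of_nonempty (fun h _ => ?_) (fun h _ => ?_) ⟨1, Finset.mem_univ _⟩
    · exact pos_iff_ne_zero.2 (w.ne_zero_iff.2 (by simpa using ha0))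
    · have : τ * h.1 ∉ H := fun hm => hτ ((Subgroup.mul_mem_cancel_right H h.2).1 hm)
      rw [hH] at this
      push Not at this
      exact ha' (τ * h.1) this
  have hb1 : w (1 + b) = w b := w.map_add_eq_of_lt_right (by rwa [map_one])
  have hb0 : w b ≠ 0 := (zero_lt_one.trans hb).ne'
  have hb10 : 1 + b ≠ 0 := w.ne_zero_iff.1 (hb1 ▸ hb0)
  refine ⟨b / (1 + b), ?_, ?_, fun τ => ?_⟩
  · rw [map_div₀, hb1, div_self hb0]
  · have : b / (1 + b) - 1 = -(1 + b)⁻¹ := by field_simp; ring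
    rw [this, Valuation.map_neg, map_inv₀, hb1]
    exact inv_lt_one_of_one_lt₀ hb
  · by_cases hτ : τ ∈ H
    · exact .inl ⟨hτ, by rw [map_div₀, map_add, map_one, hbH τ hτ]⟩
    · have h1 : w (1 + τ b) = 1 := w.map_one_add_of_lt (hb' τ hτ)
      refine .inr ⟨by rw [hH] at hτ; push Not at hτ; exact hτ, ?_⟩
      rw [map_div₀, map_div₀, map_add, map_one, h1, div_one]
      exact hb' τ hτ

/-- Over a base with simple-root lifting, the Galois group of a finite Galois extension preserves
every extension of the valuation. -/
theorem valuation_galois_apply_of_finite [FiniteDimensional F L] [IsGalois F L]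
    (hw : HasSimpleRootLifting (w.comap (algebraMap F L))) {π : F} (hπ0 : π ≠ 0)
    (hπ : w (algebraMap F L π) < 1) (σ : L ≃ₐ[F] L) (x : L) : w (σ x) = w x := by
  obtain ⟨β, hβ, hβ1, hG⟩ := exists_separating_element w hπ0 hπ
  have hint : IsIntegral F β := Algebra.IsIntegral.isIntegral β
  set f := minpoly F β with hf
  have hsplit : (f.map (algebraMap F L)).Splits := Normal.splits inferInstance β
  have hmonic : (f.map (algebraMap F L)).Monic := (minpoly.monic hint).map _
  have hprod := hsplit.eq_prod_roots_of_monic hmonic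
  have hnodup : (f.map (algebraMap F L)).roots.Nodup :=
    nodup_roots (Polynomial.Separable.map (Algebra.IsSeparable.isSeparable F β))
  have hmem : β ∈ (f.map (algebraMap F L)).roots := by
    rw [mem_roots hmonic.ne_zero, IsRoot, eval_map_algebraMap]
    exact minpoly.aeval F β
  have hroot (r : L) (hr : r ∈ (f.map (algebraMap F L)).roots) : w r ≤ 1 ∧ (r ≠ β → w r < 1) := by
    rw [mem_roots hmonic.ne_zero, IsRoot, eval_map_algebraMap] at hr
    obtain ⟨τ, rfl⟩ := minpoly.exists_algEquiv_of_root' hint.isAlgebraic hr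
    obtain ⟨-, h⟩ | ⟨-, h⟩ := hG τ
    · rw [h]
      exact ⟨hβ.le, fun h => absurd rfl h⟩
    · exact ⟨h.le, fun _ => h⟩
  obtain ⟨s, hs⟩ := Multiset.exists_cons_of_mem hmem
  rw [hs] at hprod hnodup hroot
  rw [Multiset.map_cons, Multiset.prod_cons] at hprod
  set g := (s.map fun r => X - C r).prod with hg
  have hgc : ∀ i, w (g.coeff i) ≤ 1 :=
    valuation_coeff_prod_X_sub_C_le_one w fun r hr => (hroot r (Multiset.mem_cons_of_mem hr)).1
  have hg1 : w (g.eval 1) = 1 := by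
    rw [hg, eval_multiset_prod, map_multiset_prod, Multiset.map_map, Multiset.map_map]
    refine Multiset.prod_eq_one fun y hy => ?_
    obtain ⟨r, hr, rfl⟩ := Multiset.mem_map.1 hy
    have : r ≠ β := fun h => (Multiset.nodup_cons.1 hnodup).1 (h ▸ hr)
    simpa using w.map_one_sub_of_lt ((hroot r (Multiset.mem_cons_of_mem hr)).2 this)
  have hβ1' : w (1 - β) < 1 := by rwa [Valuation.map_sub_swap]
  obtain ⟨a, ha⟩ := hw f (fun i => by
      rw [Valuation.comap_apply, ← coeff_map, hprod, hg, ← Multiset.prod_cons,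
        ← Multiset.map_cons (fun r => X - C r)]
      exact valuation_coeff_prod_X_sub_C_le_one w (fun r hr => (hroot r hr).1) i)
    1 (by simp)
    (by
      rw [Valuation.comap_apply, ← eval_map_apply, hprod, map_one, eval_mul, map_mul, hg1]
      simpa using hβ1')
    (by
      rw [Valuation.comap_apply, ← eval_map_apply, ← derivative_map, hprod, map_one,
        derivative_mul]
      simp only [derivative_sub, derivative_X, derivative_C, sub_zero, one_mul, eval_add,
        eval_mul, eval_sub, eval_X, eval_C]
      rw [w.map_add_eq_of_lt_left, hg1]
      rw [hg1, map_mul]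
      exact mul_lt_one_of_nonneg_of_lt_one_left zero_le hβ1'
        (valuation_eval_le_one w (valuation_coeff_derivative_le_one w hgc) (by simp)))
  have haβ : algebraMap F L a = β := minpoly.root hint ha
  obtain ⟨h, -⟩ | ⟨-, h⟩ := hG σ
  · exact h x
  · rw [← haβ, AlgEquiv.commutes, haβ, hβ] at h
    exact absurd h (lt_irrefl 1)

/-- Over a base with simple-root lifting, the Galois group of a Galois extension preserves
every extension of the valuation. -/
theorem valuation_galois_apply [IsGalois F L]
    (hw : HasSimpleRootLifting (w.comap (algebraMap F L))) {π : F} (hπ0 : π ≠ 0)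
    (hπ : w (algebraMap F L π) < 1) (σ : L ≃ₐ[F] L) (x : L) : w (σ x) = w x := by
  let M := FiniteGaloisIntermediateField.adjoin F {x}
  have hx : x ∈ M.toIntermediateField :=
    FiniteGaloisIntermediateField.subset_adjoin F {x} rfl
  have := valuation_galois_apply_of_finite (w.comap (algebraMap M.toIntermediateField L)) hw hπ0 hπ
    (σ.restrictNormal M.toIntermediateField) ⟨x, hx⟩
  rwa [Valuation.comap_apply, Valuation.comap_apply, AlgEquiv.restrictNormal_commutes] at this

end HenselianUniqueness

section ResidueField

open Polynomial NNReal

variable {K Ω : Type*} [Field K] [Field Ω] [Algebra K Ω] (w : Valuation Ω ℝ≥0)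

instance hasExtension_comap : (w.comap (algebraMap K Ω)).HasExtension w :=
  ⟨Valuation.IsEquiv.refl⟩

/-- The action of the Galois group on the valuation ring of an invariant valuation. -/
@[reducible]
def galoisActionOnIntegers (hinv : ∀ (σ : Ω ≃ₐ[K] Ω) x, w (σ x) = w x) :
    MulSemiringAction (Ω ≃ₐ[K] Ω) w.valuationSubring where
  smul σ b := ⟨σ b, (hinv σ b).trans_le b.2⟩
  one_smul _ := rfl
  mul_smul _ _ _ := rfl
  smul_zero σ := Subtype.ext (map_zero σ)
  smul_add σ _ _ := Subtype.ext (map_add σ _ _)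
  smul_one σ := Subtype.ext (map_one σ)
  smul_mul σ _ _ := Subtype.ext (map_mul σ _ _)

theorem isIntegral_integers_and_exists_lift_residue [IsGalois K Ω]
    (hinv : ∀ (σ : Ω ≃ₐ[K] Ω) x, w (σ x) = w x) :
    Algebra.IsIntegral (w.comap (algebraMap K Ω)).valuationSubring w.valuationSubring ∧
    ∀ s : Ω ≃+* Ω, (∀ x, w (s x) = w x) →
      (∀ x : K, w (algebraMap K Ω x) ≤ 1 → w (s (algebraMap K Ω x) - algebraMap K Ω x) < 1) →
      ∃ τ : Ω ≃ₐ[K] Ω, ∀ y, w y ≤ 1 → w (τ y - s y) < 1 := by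
  let A := (w.comap (algebraMap K Ω)).valuationSubring
  let B := w.valuationSubring
  let Q : Ideal B := IsLocalRing.maximalIdeal B
  let P : Ideal A := IsLocalRing.maximalIdeal A
  have hmk (x y : B) : Ideal.Quotient.mk Q x = Ideal.Quotient.mk Q y ↔ w (x - y : Ω) < 1 := by
    rw [Ideal.Quotient.eq, Valuation.mem_maximalIdeal_iff]
    rfl
  let _ : MulSemiringAction (Ω ≃ₐ[K] Ω) B := galoisActionOnIntegers w hinv
  have hsmul (σ : Ω ≃ₐ[K] Ω) (b : B) : ((σ • b : B) : Ω) = σ b := rfl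
  let _ : TopologicalSpace B := ⊥
  have : DiscreteTopology B := ⟨rfl⟩
  have : SMulCommClass (Ω ≃ₐ[K] Ω) A B := ⟨fun σ a b => Subtype.ext (map_smul σ (a : K) (b : Ω))⟩
  have : ContinuousSMul (Ω ≃ₐ[K] Ω) B := by
    rw [continuousSMul_iff_stabilizer_isOpen]
    intro b
    convert! stabilizer_isOpen_of_isIntegral (K := K) (b : Ω) using 2
    ext σ
    simp only [MulAction.mem_stabilizer_iff, Subtype.ext_iff, hsmul, AlgEquiv.smul_def]
  have : Algebra.IsInvariant A B (Ω ≃ₐ[K] Ω) := by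
    refine ⟨fun b hb => ?_⟩
    obtain ⟨a, ha⟩ := (InfiniteGalois.mem_range_algebraMap_iff_fixed (b : Ω)).2
      fun σ => congrArg Subtype.val (hb σ)
    exact ⟨⟨a, show w _ ≤ 1 by rw [ha]; exact b.2⟩, Subtype.ext ha⟩
  refine ⟨Algebra.IsInvariant.isIntegral_of_profinite (G := Ω ≃ₐ[K] Ω), fun s hs hsK => ?_⟩
  let sB : B ≃+* B := s.restrict B B
    (fun x => by rw [Valuation.mem_valuationSubring_iff, Valuation.mem_valuationSubring_iff, hs])
  have hsB (x : B) : ((sB x : B) : Ω) = s x := rfl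
  have hQ : Q = Q.map (sB : B →+* B) := by
    ext x
    obtain ⟨y, rfl⟩ := sB.surjective x
    rw [Ideal.map_comap_of_equiv]
    simp only [Ideal.mem_comap, RingEquiv.symm_apply_apply]
    rw [Valuation.mem_maximalIdeal_iff, Valuation.mem_maximalIdeal_iff, hsB, hs]
  let sQ : (B ⧸ Q) ≃ₐ[A ⧸ P] (B ⧸ Q) :=
    AlgEquiv.ofRingEquiv (f := Ideal.quotientEquiv Q Q sB hQ) (by
      rintro ⟨x⟩
      exact (hmk _ _).2 (hsK x x.2))
  obtain ⟨τ, hτ⟩ := Ideal.Quotient.stabilizerHom_surjective_of_profinite (G := Ω ≃ₐ[K] Ω) P Q sQ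
  refine ⟨τ, fun y hy => ?_⟩
  exact (hmk (τ • ⟨y, hy⟩) (sB ⟨y, hy⟩)).1 (DFunLike.congr_fun hτ (Ideal.Quotient.mk Q ⟨y, hy⟩))

end ResidueField

section Unramified

open Polynomial NNReal

variable {F Ω : Type*} [Field F] [Field Ω] [Algebra F Ω] (w : Valuation Ω ℝ≥0)

theorem perfectField_residueField {F : Type*} [Field F] (w : Valuation F ℝ≥0)
    (hperf : ∀ p : ℕ, p.Prime → w (p : F) < 1 → ∀ x : F, w x ≤ 1 →
      ∃ y : F, w y ≤ 1 ∧ w (x - y ^ p) < 1) :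
    PerfectField (IsLocalRing.ResidueField w.valuationSubring) := by
  let k := IsLocalRing.ResidueField w.valuationSubring
  obtain ⟨p, hp⟩ := CharP.exists k
  obtain hprime | rfl := CharP.char_is_prime_or_zero k p
  · have : ExpChar k p := ExpChar.prime hprime
    have hp1 : w (p : F) < 1 := by
      have h : IsLocalRing.residue w.valuationSubring p = 0 := by
        rw [map_natCast, CharP.cast_eq_zero]
      rw [IsLocalRing.residue_eq_zero_iff, Valuation.mem_maximalIdeal_iff] at h
      exact_mod_cast h
    have : PerfectRing k p := PerfectRing.ofSurjective k p fun z => by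
      obtain ⟨x, rfl⟩ := IsLocalRing.residue_surjective z
      obtain ⟨y, hy, hxy⟩ := hperf p hprime hp1 x x.2
      refine ⟨IsLocalRing.residue _ ⟨y, hy⟩, ?_⟩
      rw [frobenius_def, ← map_pow, eq_comm, ← sub_eq_zero, ← map_sub,
        IsLocalRing.residue_eq_zero_iff, Valuation.mem_maximalIdeal_iff]
      exact hxy
    exact PerfectRing.toPerfectField k p
  · have : CharZero k := CharP.charP_to_charZero k
    infer_instance

/-- Every integral element of `E` is residually congruent to an element of `E` which is a
simple root, modulo the maximal ideal, of an integral polynomial over `F`. -/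
theorem exists_unramified_lift [IsSepClosure F Ω]
    (hinv : ∀ (σ : Ω ≃ₐ[F] Ω) x, w (σ x) = w x)
    (hperf : PerfectField (IsLocalRing.ResidueField (w.comap (algebraMap F Ω)).valuationSubring))
    (E : IntermediateField F Ω) {x : Ω} (hxE : x ∈ E) (hx : w x ≤ 1) :
    ∃ u ∈ E, w (x - u) < 1 ∧ ∃ f : F[X], (∀ i, w (algebraMap F Ω (f.coeff i)) ≤ 1) ∧
      aeval u f = 0 ∧ w (aeval u (derivative f)) = 1 := by
  let A := (w.comap (algebraMap F Ω)).valuationSubring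
  let B := w.valuationSubring
  have hG : IsGalois F Ω := IsSepClosure.isGalois
  have hsc : IsSepClosed Ω := IsSepClosure.sep_closed F
  have hint : Algebra.IsIntegral A B := (isIntegral_integers_and_exists_lift_residue w hinv).1
  let k := IsLocalRing.ResidueField A
  let l := IsLocalRing.ResidueField B
  let xB : B := ⟨x, hx⟩
  let xl : l := IsLocalRing.residue B xB
  have hres (p : A[X]) (b : B) :
      IsLocalRing.residue B (aeval b p) = aeval (IsLocalRing.residue B b)
        (p.map (IsLocalRing.residue A)) := by
    rw [aeval_def, hom_eval₂, aeval_def, eval₂_map]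
    rfl
  have hxint : IsIntegral k xl := by
    obtain ⟨p, hp, hpx⟩ := hint.isIntegral xB
    refine ⟨p.map (IsLocalRing.residue A), hp.map _, ?_⟩
    rw [← aeval_def, ← hres, aeval_def, hpx, map_zero]
  obtain ⟨P, hP, -, hPm⟩ := lifts_and_natDegree_eq_and_monic
    ((mem_lifts _).2 (map_surjective _ IsLocalRing.residue_surjective (minpoly k xl)))
    (minpoly.monic hxint)
  have hirr : Irreducible (P.map (algebraMap A F)) :=
    hPm.irreducible_iff_irreducible_map_fraction_map.1
      (hPm.irreducible_of_irreducible_map _ _ (hP ▸ minpoly.irreducible hxint))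
  have hsep : (minpoly k xl).Separable := PerfectField.separable_of_irreducible
    (minpoly.irreducible hxint)
  set f : F[X] := P.map (algebraMap A F) with hf
  have hfsep : f.Separable := by
    rw [separable_iff_derivative_ne_zero hirr, hf, derivative_map]
    intro h
    rw [Polynomial.map_eq_zero_iff (FaithfulSMul.algebraMap_injective A F)] at h
    refine hsep.aeval_derivative_ne_zero (minpoly.aeval k xl) ?_
    rw [← hP, derivative_map, h, Polynomial.map_zero, map_zero]
  have hcoe (p : A[X]) (b : B) :
      ((aeval b p : B) : Ω) = aeval (b : Ω) (p.map (algebraMap A F)) := by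
    rw [aeval_map_algebraMap, aeval_def, aeval_def]
    exact hom_eval₂ p (algebraMap A B) B.subtype b
  have hfx : w (aeval x f) < 1 := by
    have : IsLocalRing.residue B (aeval xB P) = 0 := by
      rw [hres, hP, minpoly.aeval]
    rwa [IsLocalRing.residue_eq_zero_iff, Valuation.mem_maximalIdeal_iff, hcoe] at this
  have hfx' : w (aeval x (derivative f)) = 1 := by
    have : IsLocalRing.residue B (aeval xB (derivative P)) ≠ 0 := by
      rw [hres, ← derivative_map, hP]
      exact hsep.aeval_derivative_ne_zero (minpoly.aeval k xl)
    rw [Ne, IsLocalRing.residue_eq_zero_iff, Valuation.mem_maximalIdeal_iff, not_lt] at this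
    rw [hf, derivative_map, ← hcoe (derivative P) xB]
    exact le_antisymm (aeval xB (derivative P)).2 this
  have hfc (i : ℕ) : w (algebraMap F Ω (f.coeff i)) ≤ 1 := by
    rw [hf, coeff_map]
    exact (P.coeff i).2
  set g : Polynomial Ω := f.map (algebraMap F Ω) with hg
  have hgc (i : ℕ) : w (g.coeff i) ≤ 1 := by
    rw [hg, coeff_map]
    exact hfc i
  have hgm : g.Monic := (hPm.map _).map _
  have hgprod := (hsc.splits_of_separable g hfsep.map).eq_prod_roots_of_monic hgm
  obtain ⟨u, hu, hxu⟩ : ∃ u ∈ g.roots, w (x - u) < 1 := by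
    by_contra! hcon
    refine hfx.not_ge ?_
    rw [← eval_map_algebraMap, ← hg, hgprod, eval_multiset_prod, map_multiset_prod,
      Multiset.map_map, Multiset.map_map]
    refine Multiset.one_le_prod fun y hy => ?_
    obtain ⟨r, hr, rfl⟩ := Multiset.mem_map.1 hy
    simpa using hcon r hr
  rw [mem_roots hgm.ne_zero, IsRoot] at hu
  have hux : w (u - x) < 1 := by rwa [Valuation.map_sub_swap]
  have hu1 : w u ≤ 1 := by
    rw [← sub_add_cancel u x]
    exact (w.map_add _ _).trans (max_le hux.le hx)
  have hgd (z : Ω) : eval z (derivative g) = aeval z (derivative f) := by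
    rw [hg, derivative_map, eval_map_algebraMap]
  have hu' : w (eval u (derivative g)) = 1 := by
    have h1 : w (eval u (derivative g) - eval x (derivative g)) < 1 :=
      (valuation_eval_sub_eval_le w (valuation_coeff_derivative_le_one w hgc) hu1 hx).trans_lt hux
    rw [← hfx', ← hgd] at h1
    rw [← sub_add_cancel (eval u (derivative g)) (eval x (derivative g)),
      w.map_add_eq_of_lt_right h1, hgd, hfx']
  refine ⟨u, ?_, hxu, f, hfc, by rw [← eval_map_algebraMap, ← hg, hu], by rw [← hgd, hu']⟩
  rw [← InfiniteGalois.fixedField_fixingSubgroup (L := E), IntermediateField.mem_fixedField_iff]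
  intro τ hτ
  have hτx : τ x = x := (IntermediateField.mem_fixingSubgroup_iff E τ).1 hτ x hxE
  refine root_eq_of_valuation_sub_lt_one w hgc hu1 ((hinv τ u).trans_le hu1) hu ?_ hu' ?_
  · rw [hg, eval_map_algebraMap, ← AlgEquiv.coe_toAlgHom, aeval_algHom_apply,
      ← eval_map_algebraMap, ← hg, hu, map_zero]
  · have : τ u - u = τ (u - x) + (x - u) := by rw [map_sub, hτx]; ring
    rw [this]
    exact (w.map_add _ _).trans_lt (max_lt (by rwa [hinv]) hxu)

end Unramified

section CountingEmbeddings

open Polynomial NNReal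

variable {F Ω : Type*} [Field F] [Field Ω] [Algebra F Ω] (w : Valuation Ω ℝ≥0)

theorem exists_algEquiv_extending [Normal F Ω] (E : IntermediateField F Ω) (σ : E →ₐ[F] Ω) :
    ∃ s : Ω ≃ₐ[F] Ω, ∀ x : E, s x = σ x :=
  ⟨AlgEquiv.ofBijective (σ.liftNormal Ω) (AlgHom.normal_bijective F Ω Ω _),
    fun x => σ.liftNormal_commutes Ω x⟩

/-- Expansion of an integral element of `E` to first order in a uniformizer `π`, the constant
term being fixed by every automorphism that moves it by less than one. -/
theorem exists_eq_add_uniformizer_mul [IsSepClosure F Ω]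
    (hinv : ∀ (σ : Ω ≃ₐ[F] Ω) x, w (σ x) = w x)
    (hperf : PerfectField (IsLocalRing.ResidueField (w.comap (algebraMap F Ω)).valuationSubring))
    {E : IntermediateField F Ω} {π : Ω} (hπE : π ∈ E) (hπ0 : π ≠ 0)
    (hπ : ∀ x ∈ E, w x < 1 → w x ≤ w π) {x : Ω} (hxE : x ∈ E) (hx : w x ≤ 1) :
    ∃ u ∈ E, ∃ z ∈ E, w u ≤ 1 ∧ w z ≤ 1 ∧ x = u + π * z ∧
      ∀ s : Ω ≃ₐ[F] Ω, w (s u - u) < 1 → s u = u := by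
  obtain ⟨u, huE, hxu, f, hfc, hfu, hfu'⟩ := exists_unramified_lift w hinv hperf E hxE hx
  have hu : w u ≤ 1 := by
    rw [← sub_sub_cancel x u]
    exact (w.map_sub _ _).trans (max_le hx hxu.le)
  refine ⟨u, huE, (x - u) / π, div_mem (sub_mem hxE huE) hπE, hu, ?_, by field_simp; ring, ?_⟩
  · rw [map_div₀]
    exact div_le_one_of_le₀ (hπ _ (sub_mem hxE huE) hxu) zero_le
  · intro s hs
    refine root_eq_of_valuation_sub_lt_one w (p := f.map (algebraMap F Ω)) (fun i => ?_) hu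
      ((hinv s u).trans_le hu) ?_ ?_ ?_ hs
    · rw [coeff_map]
      exact hfc i
    · rw [eval_map_algebraMap, hfu]
    · rw [eval_map_algebraMap, ← AlgEquiv.coe_toAlgHom, aeval_algHom_apply, hfu, map_zero]
    · rw [derivative_map, eval_map_algebraMap, hfu']

theorem algEquiv_eqOn_of_apply_uniformizer_eq [IsSepClosure F Ω]
    (hinv : ∀ (σ : Ω ≃ₐ[F] Ω) x, w (σ x) = w x)
    (hperf : PerfectField (IsLocalRing.ResidueField (w.comap (algebraMap F Ω)).valuationSubring))
    {E : IntermediateField F Ω} {π : Ω} (hπE : π ∈ E) (hπ0 : π ≠ 0) (hπ1 : w π < 1)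
    (hπ : ∀ x ∈ E, w x < 1 → w x ≤ w π) {s t : Ω ≃ₐ[F] Ω}
    (hs : ∀ x ∈ E, w x ≤ 1 → w (s x - x) < 1) (ht : ∀ x ∈ E, w x ≤ 1 → w (t x - x) < 1)
    (hst : s π = t π) {x : Ω} (hxE : x ∈ E) : s x = t x := by
  have key (n : ℕ) : ∀ x ∈ E, w x ≤ 1 → w (s x - t x) ≤ w π ^ n := by
    induction n with
    | zero =>
      intro x hxE hx
      rw [pow_zero]
      refine (w.map_sub _ _).trans (max_le ?_ ?_) <;> rwa [hinv]
    | succ n ih =>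
      intro x hxE hx
      obtain ⟨u, huE, z, hzE, hu, hz, rfl, h⟩ :=
        exists_eq_add_uniformizer_mul w hinv hperf hπE hπ0 hπ hxE hx
      have hd : s (u + π * z) - t (u + π * z) = t π * (s z - t z) := by
        rw [map_add, map_add, map_mul, map_mul, h s (hs u huE hu), h t (ht u huE hu), hst]
        ring
      rw [hd, map_mul, hinv, pow_succ']
      gcongr
      exact ih z hzE hz
  have hint {x : Ω} (hxE : x ∈ E) (hx : w x ≤ 1) : s x = t x := by
    rw [← sub_eq_zero, ← w.zero_iff]
    exact le_antisymm (ge_of_tendsto' (NNReal.tendsto_pow_atTop_nhds_zero_of_lt_one hπ1)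
      fun n => key n x hxE hx) zero_le
  obtain hx | hx := le_total (w x) 1
  · exact hint hxE hx
  · have := hint (inv_mem hxE) (by rw [map_inv₀]; exact inv_le_one_of_one_le₀ hx)
    rwa [map_inv₀, map_inv₀, inv_inj] at this

theorem valuation_algEquiv_apply_sub_le [IsSepClosure F Ω]
    (hinv : ∀ (σ : Ω ≃ₐ[F] Ω) x, w (σ x) = w x)
    (hperf : PerfectField (IsLocalRing.ResidueField (w.comap (algebraMap F Ω)).valuationSubring))
    {E : IntermediateField F Ω} {π : Ω} (hπE : π ∈ E) (hπ0 : π ≠ 0) (hπ1 : w π < 1)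
    (hπ : ∀ x ∈ E, w x < 1 → w x ≤ w π) {s : Ω ≃ₐ[F] Ω}
    (hs : ∀ x ∈ E, w x ≤ 1 → w (s x - x) < 1) {c : ℝ≥0} (hsπ : w (s π - π) ≤ c)
    {x : Ω} (hxE : x ∈ E) (hx : w x ≤ 1) : w (s x - x) ≤ c := by
  have key (n : ℕ) : ∀ x ∈ E, w x ≤ 1 → w (s x - x) ≤ max c (w π ^ n) := by
    induction n with
    | zero =>
      intro x hxE hx
      rw [pow_zero]
      exact (hs x hxE hx).le.trans (le_max_right _ _)
    | succ n ih =>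
      intro x hxE hx
      obtain ⟨u, huE, z, hzE, hu, hz, rfl, h⟩ :=
        exists_eq_add_uniformizer_mul w hinv hperf hπE hπ0 hπ hxE hx
      have hd : s (u + π * z) - (u + π * z) = (s π - π) * s z + π * (s z - z) := by
        rw [map_add, map_mul, h s (hs u huE hu)]
        ring
      rw [hd]
      refine (w.map_add _ _).trans (max_le ?_ ?_)
      · rw [map_mul, hinv]
        exact (mul_le_of_le_one_right' hz).trans (hsπ.trans (le_max_left _ _))
      · rw [map_mul]
        refine (mul_le_mul_right (ih z hzE hz) _).trans ?_
        rw [mul_max, pow_succ']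
        exact max_le_max_right _ (mul_le_of_le_one_left' hπ1.le)
  have hlim : Filter.Tendsto (fun n => max c (w π ^ n)) Filter.atTop (nhds (max c 0)) :=
    tendsto_const_nhds.max (NNReal.tendsto_pow_atTop_nhds_zero_of_lt_one hπ1)
  rw [max_eq_left zero_le] at hlim
  exact ge_of_tendsto' hlim fun n => key n x hxE hx

theorem exists_algEquiv_eqOn_residually_trivial [IsGalois F Ω]
    (hinv : ∀ (σ : Ω ≃ₐ[F] Ω) x, w (σ x) = w x) (E₀ : IntermediateField F Ω) {s : Ω ≃ₐ[F] Ω}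
    (hs : ∀ x ∈ E₀, w x ≤ 1 → w (s x - x) < 1) :
    ∃ t : Ω ≃ₐ[F] Ω, (∀ x ∈ E₀, t x = s x) ∧ ∀ x, w x ≤ 1 → w (t x - x) < 1 := by
  obtain ⟨τ, hτ⟩ := (isIntegral_integers_and_exists_lift_residue (K := E₀) w
    fun σ x => hinv (σ.restrictScalars F) x).2 s.toRingEquiv (hinv s) fun x hx => hs x x.2 hx
  have hτinv (x : Ω) : w (τ.symm x) = w x := hinv (τ.symm.restrictScalars F) x
  refine ⟨(τ.symm.restrictScalars F).trans s, fun x hx => ?_, fun x hx => ?_⟩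
  · exact congrArg s (τ.symm.commutes ⟨x, hx⟩)
  · have := hτ (τ.symm x) (by rwa [hτinv])
    rw [τ.apply_symm_apply, w.map_sub_swap] at this
    exact this

theorem natCard_algHom_close_eq [IsSepClosure F Ω]
    (hinv : ∀ (σ : Ω ≃ₐ[F] Ω) x, w (σ x) = w x)
    (hperf : PerfectField (IsLocalRing.ResidueField (w.comap (algebraMap F Ω)).valuationSubring))
    {E₀ E : IntermediateField F Ω} (hle : E₀ ≤ E) {π : Ω} (hπE : π ∈ E₀) (hπ0 : π ≠ 0)
    (hπ1 : w π < 1) (hπ : ∀ x ∈ E, w x < 1 → w x ≤ w π) {c : ℝ≥0} (hc : c < 1) :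
    Nat.card {σ : E₀ →ₐ[F] Ω // ∀ x : E₀, w x ≤ 1 → w (σ x - x) ≤ c} =
      Nat.card {σ : E →ₐ[F] Ω // ∀ x : E, w x ≤ 1 → w (σ x - x) ≤ c} := by
  have : IsGalois F Ω := IsSepClosure.isGalois
  refine (Nat.card_congr (Equiv.ofBijective (fun σ => ⟨σ.1.comp (IntermediateField.inclusion hle),
    fun x hx => σ.2 (IntermediateField.inclusion hle x) hx⟩) ⟨?_, ?_⟩)).symm
  · rintro ⟨σ, hσ⟩ ⟨τ, hτ⟩ h
    obtain ⟨s, hs⟩ := exists_algEquiv_extending E σ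
    obtain ⟨t, ht⟩ := exists_algEquiv_extending E τ
    refine Subtype.ext (AlgHom.ext fun x => ?_)
    change σ x = τ x
    rw [← hs, ← ht]
    refine algEquiv_eqOn_of_apply_uniformizer_eq w hinv hperf (hle hπE) hπ0 hπ1 hπ
      (fun x hxE hx => ?_) (fun x hxE hx => ?_) ?_ x.2
    · exact (hs ⟨x, hxE⟩).symm ▸ (hσ ⟨x, hxE⟩ hx).trans_lt hc
    · exact (ht ⟨x, hxE⟩).symm ▸ (hτ ⟨x, hxE⟩ hx).trans_lt hc
    · have := DFunLike.congr_fun (congrArg Subtype.val h) ⟨π, hπE⟩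
      exact (hs ⟨π, hle hπE⟩).trans (this.trans (ht ⟨π, hle hπE⟩).symm)
  · rintro ⟨σ, hσ⟩
    obtain ⟨s, hs⟩ := exists_algEquiv_extending E₀ σ
    obtain ⟨t, hts, ht⟩ := exists_algEquiv_eqOn_residually_trivial w hinv E₀ (s := s)
      fun x hxE hx => (hs ⟨x, hxE⟩).symm ▸ (hσ ⟨x, hxE⟩ hx).trans_lt hc
    have htσ (x : E₀) : t x = σ x := (hts x x.2).trans (hs x)
    refine ⟨⟨t.toAlgHom.comp E.val, fun x hx => ?_⟩, Subtype.ext (AlgHom.ext htσ)⟩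
    refine valuation_algEquiv_apply_sub_le w hinv hperf (hle hπE) hπ0 hπ1 hπ
      (fun x _ hx => ht x hx) ?_ x.2 hx
    rw [htσ ⟨π, hπE⟩]
    exact hσ ⟨π, hπE⟩ hπ1.le

end CountingEmbeddings

section AddValToValuation

open Polynomial NNReal

/-- The order-reversing map `a ↦ exp (-a)` from `ℝ ∪ {⊤}` to `ℝ≥0`. -/
def expNeg : WithTop ℝ → ℝ≥0 :=
  WithTop.recTopCoe 0 fun a => Real.toNNReal (Real.exp (-a))

theorem expNeg_top : expNeg ⊤ = 0 := rfl

theorem expNeg_coe (a : ℝ) : expNeg a = Real.toNNReal (Real.exp (-a)) := rfl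

theorem expNeg_strictAnti : StrictAnti expNeg := by
  intro a b hab
  induction a with
  | top => exact (not_top_lt hab).elim
  | coe a =>
    induction b with
    | top =>
      rw [expNeg_top, expNeg_coe, Real.toNNReal_pos]
      exact Real.exp_pos _
    | coe b =>
      rw [expNeg_coe, expNeg_coe, Real.toNNReal_lt_toNNReal_iff (Real.exp_pos _),
        Real.exp_lt_exp, neg_lt_neg_iff]
      exact WithTop.coe_lt_coe.1 hab

theorem expNeg_zero : expNeg 0 = 1 := by
  rw [← WithTop.coe_zero, expNeg_coe, neg_zero, Real.exp_zero, Real.toNNReal_one]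

theorem expNeg_add (a b : WithTop ℝ) : expNeg (a + b) = expNeg a * expNeg b := by
  induction a with
  | top => rw [top_add, expNeg_top, zero_mul]
  | coe a =>
    induction b with
    | top => rw [add_top, expNeg_top, mul_zero]
    | coe b =>
      rw [← WithTop.coe_add, expNeg_coe, expNeg_coe, expNeg_coe,
        ← Real.toNNReal_mul (Real.exp_pos _).le, ← Real.exp_add, neg_add]

variable {Ω : Type*} [Field Ω] (V : AddVal Ω)

theorem AddVal.v_one_s5 : V.v 1 = 0 := by
  have h := V.v_mul 1 1
  obtain ⟨a, ha⟩ := WithTop.ne_top_iff_exists.1 (V.v_ne_top 1 one_ne_zero)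
  rw [mul_one, ← ha, ← WithTop.coe_add, WithTop.coe_inj, left_eq_add] at h
  rw [← ha, h, WithTop.coe_zero]

/-- The multiplicative valuation `exp (-v)` attached to an additive valuation `v`. -/
def AddVal.toValuation : Valuation Ω ℝ≥0 where
  toFun x := expNeg (V.v x)
  map_zero' := by rw [V.v_zero, expNeg_top]
  map_one' := by rw [V.v_one_s5, expNeg_zero]
  map_mul' x y := by rw [V.v_mul, expNeg_add]
  map_add_le_max' x y := by
    rw [← expNeg_strictAnti.antitone.map_min]
    exact expNeg_strictAnti.antitone (V.v_min_le_add x y)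

theorem AddVal.toValuation_apply (x : Ω) : V.toValuation x = expNeg (V.v x) := rfl

theorem AddVal.toValuation_le_expNeg_iff {a : WithTop ℝ} {x : Ω} :
    V.toValuation x ≤ expNeg a ↔ a ≤ V.v x :=
  expNeg_strictAnti.le_iff_ge

theorem AddVal.toValuation_le_one_iff {x : Ω} : V.toValuation x ≤ 1 ↔ 0 ≤ V.v x := by
  rw [← expNeg_zero, V.toValuation_le_expNeg_iff]

theorem AddVal.toValuation_lt_one_iff {x : Ω} : V.toValuation x < 1 ↔ 0 < V.v x := by
  rw [← expNeg_zero]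
  exact expNeg_strictAnti.lt_iff_gt

theorem AddVal.toValuation_eq_one_iff {x : Ω} : V.toValuation x = 1 ↔ V.v x = 0 := by
  rw [← expNeg_zero]
  exact expNeg_strictAnti.injective.eq_iff

variable {V} {F : Type*} [Field F] [Algebra F Ω]

theorem AddVal.IsHenselianOn.hasSimpleRootLifting (h : V.IsHenselianOn F) :
    HasSimpleRootLifting (V.toValuation.comap (algebraMap F Ω)) := by
  intro f hf a₀ ha₀ hfa hfa'
  obtain ⟨a, ha, -⟩ := h f (fun i => V.toValuation_le_one_iff.1 (hf i)) a₀
    (V.toValuation_le_one_iff.1 ha₀) (V.toValuation_lt_one_iff.1 hfa)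
    (V.toValuation_eq_one_iff.1 hfa')
  exact ⟨a, ha⟩

theorem AddVal.HasPerfectResidueFieldOn.perfectField_residueField
    (h : V.HasPerfectResidueFieldOn F) :
    PerfectField (IsLocalRing.ResidueField
      (V.toValuation.comap (algebraMap F Ω)).valuationSubring) := by
  refine _root_.perfectField_residueField _ fun p hp hp1 x hx => ?_
  obtain ⟨y, hy, hxy⟩ := h p hp (V.toValuation_lt_one_iff.1 hp1) x
    (V.toValuation_le_one_iff.1 hx)
  exact ⟨y, V.toValuation_le_one_iff.2 hy, V.toValuation_lt_one_iff.2 hxy⟩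

theorem AddVal.IsNormalizedOn.toValuation_algEquiv_apply [IsSepClosure F Ω]
    (hnorm : V.IsNormalizedOn F) (hhens : V.IsHenselianOn F) (σ : Ω ≃ₐ[F] Ω) (x : Ω) :
    V.toValuation (σ x) = V.toValuation x := by
  have : IsGalois F Ω := IsSepClosure.isGalois
  obtain ⟨π, hπ⟩ := hnorm.2
  refine valuation_galois_apply V.toValuation hhens.hasSimpleRootLifting (π := π) ?_ ?_ σ x
  · rintro rfl
    rw [map_zero, V.v_zero] at hπ
    exact WithTop.top_ne_coe hπ
  · rw [V.toValuation_lt_one_iff, hπ]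
    exact WithTop.coe_pos.2 one_pos

theorem AddVal.IsRamIdx.toValuation_le {E : IntermediateField F Ω} {e : ℕ}
    (he : V.IsRamIdx E e) {π : Ω} (hπ : V.v π = ((1 / (e : ℝ) : ℝ) : WithTop ℝ)) {x : Ω}
    (hxE : x ∈ E) (hx : V.toValuation x < 1) : V.toValuation x ≤ V.toValuation π := by
  rw [V.toValuation_apply π, V.toValuation_le_expNeg_iff, hπ]
  by_cases hx0 : x = 0
  · rw [hx0, V.v_zero]
    exact le_top
  · obtain ⟨k, hk⟩ := he.2.1 ⟨x, hxE⟩ fun h => hx0 (congrArg Subtype.val h)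
    have he0 : (0 : ℝ) < e := Nat.cast_pos.2 he.1
    rw [V.toValuation_lt_one_iff, hk, ← WithTop.coe_zero, WithTop.coe_lt_coe,
      lt_div_iff₀ he0, zero_mul, Int.cast_pos] at hx
    rw [hk, WithTop.coe_le_coe]
    gcongr
    exact_mod_cast hx

theorem gfun_eq_natCard (E : IntermediateField F Ω) (e : ℕ) (r : ℝ) :
    gfun V E e r = Nat.card {σ : E →ₐ[F] Ω // ∀ x : E, V.toValuation x ≤ 1 →
      V.toValuation (σ x - x) ≤ expNeg ((r + 1) / (e : ℝ) : ℝ)} := by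
  simp only [gfun, xiRel, V.toValuation_le_one_iff, V.toValuation_le_expNeg_iff]
  rfl

theorem gfun_eq_of_le [IsSepClosure F Ω] (hnorm : V.IsNormalizedOn F)
    (hhens : V.IsHenselianOn F) (hperf : V.HasPerfectResidueFieldOn F)
    {E₀ E : IntermediateField F Ω} (hle : E₀ ≤ E) {e : ℕ} (he₀ : V.IsRamIdx E₀ e)
    (he : V.IsRamIdx E e) {r : ℝ} (hr : -1 < r) : gfun V E₀ e r = gfun V E e r := by
  obtain ⟨π, hπ⟩ := he₀.2.2
  have he0 : (0 : ℝ) < e := Nat.cast_pos.2 he.1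
  rw [gfun_eq_natCard, gfun_eq_natCard]
  refine natCard_algHom_close_eq V.toValuation (hnorm.toValuation_algEquiv_apply hhens)
    hperf.perfectField_residueField hle π.2 ?_ ?_ (fun x => he.toValuation_le hπ) ?_
  · intro h
    rw [h, V.v_zero] at hπ
    exact WithTop.top_ne_coe hπ
  · rw [V.toValuation_lt_one_iff, hπ, ← WithTop.coe_zero, WithTop.coe_lt_coe]
    positivity
  · rw [← expNeg_zero]
    refine expNeg_strictAnti ?_
    rw [← WithTop.coe_zero, WithTop.coe_lt_coe]
    exact div_pos (by linarith) he0

theorem herbrand_nonpos (E : IntermediateField F Ω) (e : ℕ) {r : ℝ} (hr : r ≤ 0) :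
    herbrand V E e r ≤ 0 := by
  rw [herbrand, intervalIntegral.integral_symm, neg_nonpos]
  exact intervalIntegral.integral_nonneg hr fun t _ => by positivity

theorem nonneg_of_rightInverse_herbrand {E : IntermediateField F Ω} {e : ℕ} {ψ : ℝ → ℝ}
    (hψ : ∀ r : ℝ, 0 ≤ r → ψ (herbrand V E e r) = r ∧ herbrand V E e (ψ r) = r)
    {r : ℝ} (hr : 0 ≤ r) : 0 ≤ ψ r := by
  by_contra! h
  have h0 : ψ 0 = 0 := by
    have := (hψ 0 le_rfl).1
    rwa [herbrand, intervalIntegral.integral_same] at this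
  have hr0 : r = 0 := le_antisymm ((hψ r hr).2 ▸ herbrand_nonpos E e h.le) hr
  rw [hr0, h0] at h
  exact lt_irrefl _ h

theorem exists_finite_subextension_isRamIdx [Algebra.IsAlgebraic F Ω]
    {E : IntermediateField F Ω} {e : ℕ} (he : V.IsRamIdx E e) :
    ∃ E₀ : IntermediateField F Ω, E₀ ≤ E ∧ FiniteDimensional F E₀ ∧ V.IsRamIdx E₀ e := by
  obtain ⟨π, hπ⟩ := he.2.2
  have hle : IntermediateField.adjoin F {(π : Ω)} ≤ E :=
    IntermediateField.adjoin_simple_le_iff.2 π.2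
  refine ⟨_, hle, IntermediateField.adjoin.finiteDimensional
    (Algebra.IsIntegral.isIntegral (π : Ω)), he.1, fun x hx => ?_,
    ⟨_, IntermediateField.mem_adjoin_simple_self F (π : Ω)⟩, hπ⟩
  refine he.2.1 ⟨x, hle x.2⟩ fun h => hx (Subtype.ext ?_)
  exact congrArg E.val h

end AddValToValuation

/-- If `E₀/F` is a subextension of `E/F` with `e(E₀/F) = e(E/F) = e`,
then for every `r > -1` the quantity `g_r` associated to `E₀/F` equals the one associated
to `E/F`; consequently `φ_{E/F} = φ_{E₀/F}` and `ψ_{E/F} = ψ_{E₀/F}` on `[0,∞)`.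
Moreover, there always exists a *finite* subextension `E₀/F` of `E/F` with
`e(E₀/F) = e(E/F)`. -/
theorem gfun_herbrand_eq_of_subextension_same_ramification
    {F Ω : Type*} [Field F] [Field Ω] [Algebra F Ω] [IsSepClosure F Ω]
    (V : AddVal Ω) (hnorm : V.IsNormalizedOn F) (hhens : V.IsHenselianOn F)
    (hperf : V.HasPerfectResidueFieldOn F)
    (E : IntermediateField F Ω) (e : ℕ) (he : V.IsRamIdx E e) :
    (∀ E₀ : IntermediateField F Ω, E₀ ≤ E → V.IsRamIdx E₀ e →
      (∀ r : ℝ, -1 < r → gfun V E₀ e r = gfun V E e r) ∧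
      (∀ r : ℝ, 0 ≤ r → herbrand V E₀ e r = herbrand V E e r) ∧
      (∀ ψ ψ₀ : ℝ → ℝ,
        (∀ r : ℝ, 0 ≤ r → ψ (herbrand V E e r) = r ∧ herbrand V E e (ψ r) = r) →
        (∀ r : ℝ, 0 ≤ r → ψ₀ (herbrand V E₀ e r) = r ∧ herbrand V E₀ e (ψ₀ r) = r) →
        ∀ r : ℝ, 0 ≤ r → ψ r = ψ₀ r)) ∧
    (∃ E₀ : IntermediateField F Ω, E₀ ≤ E ∧ FiniteDimensional F ↥E₀ ∧
      V.IsRamIdx E₀ e) := by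
  have hG : IsGalois F Ω := IsSepClosure.isGalois
  refine ⟨fun E₀ hle he₀ => ?_, exists_finite_subextension_isRamIdx he⟩
  have hg (r : ℝ) (hr : -1 < r) : gfun V E₀ e r = gfun V E e r :=
    gfun_eq_of_le hnorm hhens hperf hle he₀ he hr
  have hφ (r : ℝ) (hr : 0 ≤ r) : herbrand V E₀ e r = herbrand V E e r := by
    refine intervalIntegral.integral_congr fun t ht => ?_
    rw [Set.uIcc_of_le hr] at ht
    simp only [hg t (by linarith [ht.1]), hg 0 (by norm_num)]
  refine ⟨hg, hφ, fun ψ ψ₀ hψ hψ₀ r hr => ?_⟩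
  have hψr := nonneg_of_rightInverse_herbrand hψ hr
  rw [← (hψ₀ (ψ r) hψr).1, hφ _ hψr, (hψ r hr).2]
end
end

section
/- Let F be a discretely valued Henselian field with perfect residue field and E/F a finite separable extension. Let F̂ denote the completion of F and Ê the completion of E, and fix an embedding of F^sep into (F̂)^sep, giving a canonical bijection Hom_{F-alg}(E, F^sep) → Hom_{F̂-alg}(Ê, (F̂)^sep) (induced by the ring isomorphism E ⊗_F F̂ ≅ Ê). Then for every r ∈ [−1,∞) this bijection respects the equivalence relations Ξ_r on the two sides; consequently φ_{E/F} = φ_{Ê/F̂} and ψ_{E/F} = ψ_{Ê/F̂} as functions [0,∞) → [0,∞). -/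
noncomputable section

open scoped Classical

/-- The image of an element of `E` under `j` lies in the compositum `Ê = E·F̂`
(the completion of `E`), realized as `adjoin F̂ (j(E))`. -/
def imgMem {Ω Ω' F' : Type*} [Field Ω] [Field Ω'] [Field F'] [Algebra F' Ω']
    (j : Ω →+* Ω') (S : Set Ω) (x : Ω) (hx : x ∈ S) :
    j x ∈ IntermediateField.adjoin F' (j '' S) :=
  IntermediateField.subset_adjoin F' (j '' S) ⟨x, hx, rfl⟩

namespace AddVal

variable {Ω : Type*} [Field Ω] (V : AddVal Ω)

theorem exists_coe {x : Ω} (hx : x ≠ 0) : ∃ r : ℝ, V.v x = (r : WithTop ℝ) :=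
  ⟨_, (WithTop.coe_untop _ (V.v_ne_top x hx)).symm⟩

theorem exists_le (x : Ω) : ∃ r : ℝ, (r : WithTop ℝ) ≤ V.v x := by
  by_cases hx : x = 0
  · exact ⟨0, by simp [hx, V.v_zero]⟩
  · obtain ⟨r, hr⟩ := V.exists_coe hx
    exact ⟨r, hr.ge⟩

theorem v_one_s6 : V.v 1 = 0 := by
  obtain ⟨r, hr⟩ := V.exists_coe (one_ne_zero (α := Ω))
  have h := V.v_mul 1 1
  rw [mul_one, hr] at h
  rw [hr]
  norm_cast at h ⊢
  linarith

theorem v_neg (x : Ω) : V.v (-x) = V.v x := by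
  obtain ⟨r, hr⟩ := V.exists_coe (neg_ne_zero.mpr (one_ne_zero (α := Ω)))
  have h := V.v_mul (-1) (-1)
  rw [neg_mul_neg, mul_one, v_one_s6, hr] at h
  norm_cast at h
  have hr0 : r = 0 := by linarith
  rw [neg_eq_neg_one_mul, V.v_mul, hr, hr0]
  simp

theorem v_sub_comm (x y : Ω) : V.v (x - y) = V.v (y - x) := by
  rw [← V.v_neg, neg_sub]

theorem le_add {b : WithTop ℝ} {x y : Ω} (hx : b ≤ V.v x) (hy : b ≤ V.v y) : b ≤ V.v (x + y) :=
  (le_min hx hy).trans (V.v_min_le_add x y)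

theorem le_sub {b : WithTop ℝ} {x y : Ω} (hx : b ≤ V.v x) (hy : b ≤ V.v y) :
    b ≤ V.v (x - y) := by
  rw [sub_eq_add_neg]
  exact V.le_add hx (by rwa [V.v_neg])

theorem le_mul {a b c : ℝ} {x y : Ω} (hx : (a : WithTop ℝ) ≤ V.v x) (hy : (b : WithTop ℝ) ≤ V.v y)
    (h : c ≤ a + b) : (c : WithTop ℝ) ≤ V.v (x * y) := by
  rw [V.v_mul]
  refine le_trans ?_ (add_le_add hx hy)
  exact_mod_cast h

theorem v_pow {x : Ω} {r : ℝ} (hx : V.v x = (r : WithTop ℝ)) (n : ℕ) :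
    V.v (x ^ n) = ((n * r : ℝ) : WithTop ℝ) := by
  induction n with
  | zero => simp [v_one_s6]
  | succ n ih =>
    rw [pow_succ, V.v_mul, ih, hx]
    norm_cast
    push_cast
    ring

theorem v_inv {x : Ω} {r : ℝ} (hx : V.v x = (r : WithTop ℝ)) :
    V.v x⁻¹ = ((-r : ℝ) : WithTop ℝ) := by
  have hx0 : x ≠ 0 := by
    rintro rfl
    rw [V.v_zero] at hx
    exact WithTop.top_ne_coe hx
  obtain ⟨s, hs⟩ := V.exists_coe (inv_ne_zero hx0)
  have h := V.v_mul x x⁻¹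
  rw [mul_inv_cancel₀ hx0, v_one_s6, hx, hs] at h
  rw [hs]
  norm_cast at h ⊢
  linarith

/-- An element close enough to `x ≠ 0` has the same valuation as `x`. -/
theorem v_eq_of_lt_sub {x y : Ω} (h : V.v x < V.v (y - x)) : V.v y = V.v x := by
  apply le_antisymm
  · by_contra! hlt
    have h1 : min (V.v y) (V.v (y - x)) ≤ V.v x := by
      have := V.le_sub (min_le_left (V.v y) (V.v (y - x))) (min_le_right _ _)
      rwa [sub_sub_cancel] at this
    exact absurd (lt_min hlt h) (not_lt.mpr h1)
  · have := V.le_add h.le le_rfl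
    rwa [sub_add_cancel] at this

/-- Multiplication is continuous for the topology of the valuation. -/
theorem exists_le_mul_sub_mul (y z : Ω) (B : ℝ) : ∃ C : ℝ, ∀ x w : Ω,
    (C : WithTop ℝ) ≤ V.v (y - x) → (C : WithTop ℝ) ≤ V.v (z - w) →
      (B : WithTop ℝ) ≤ V.v (y * z - x * w) := by
  obtain ⟨a, ha⟩ := V.exists_le y
  obtain ⟨b, hb⟩ := V.exists_le z
  refine ⟨max (max (B - a) (B - b)) (max B 0), fun x w hx hw => ?_⟩
  set C := max (max (B - a) (B - b)) (max B 0) with hC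
  have h1 : B - a ≤ C := (le_max_left _ _).trans (le_max_left _ _)
  have h2 : B - b ≤ C := (le_max_right _ _).trans (le_max_left _ _)
  have h3 : B ≤ C := (le_max_left _ _).trans (le_max_right _ _)
  have h4 : 0 ≤ C := (le_max_right _ _).trans (le_max_right _ _)
  have key : y * z - x * w = y * (z - w) + z * (y - x) - (y - x) * (z - w) := by ring
  rw [key]
  exact V.le_sub (V.le_add (V.le_mul ha hw (by linarith)) (V.le_mul hb hx (by linarith)))
    (V.le_mul hx hw (by linarith))

/-- A polynomial is bounded on the unit ball around a point. -/
theorem exists_le_eval (p : Polynomial Ω) (a : Ω) :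
    ∃ M : ℝ, ∀ b : Ω, 0 ≤ V.v (b - a) → (M : WithTop ℝ) ≤ V.v (p.eval b) := by
  induction p using Polynomial.induction_on with
  | C c =>
    obtain ⟨r, hr⟩ := V.exists_le c
    exact ⟨r, fun b _ => by simpa using hr⟩
  | add p q hp hq =>
    obtain ⟨M, hM⟩ := hp
    obtain ⟨N, hN⟩ := hq
    refine ⟨min M N, fun b hb => ?_⟩
    rw [Polynomial.eval_add]
    exact V.le_add (le_trans (by exact_mod_cast min_le_left M N) (hM b hb))
      (le_trans (by exact_mod_cast min_le_right M N) (hN b hb))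
  | monomial n c h =>
    obtain ⟨M, hM⟩ := h
    obtain ⟨r, hr⟩ := V.exists_le a
    refine ⟨M + min 0 r, fun b hb => ?_⟩
    rw [pow_succ, ← mul_assoc, Polynomial.eval_mul, Polynomial.eval_X]
    refine V.le_mul (hM b hb) (b := min 0 r) ?_ le_rfl
    have := V.le_add (b := ((min 0 r : ℝ) : WithTop ℝ))
      (le_trans (by exact_mod_cast min_le_left 0 r) hb)
      (le_trans (by exact_mod_cast min_le_right 0 r) hr)
    rwa [sub_add_cancel] at this

/-- Polynomials are Lipschitz on the unit ball around a point. -/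
theorem exists_le_eval_sub_eval (p : Polynomial Ω) (a : Ω) :
    ∃ M : ℝ, ∀ (b : Ω) (t : ℝ), 0 ≤ t → (t : WithTop ℝ) ≤ V.v (b - a) →
      ((M + t : ℝ) : WithTop ℝ) ≤ V.v (p.eval b - p.eval a) := by
  obtain ⟨q, hq⟩ := Polynomial.X_sub_C_dvd_sub_C_eval (p := p) (a := a)
  obtain ⟨M, hM⟩ := V.exists_le_eval q a
  refine ⟨M, fun b t ht hb => ?_⟩
  have h := congrArg (Polynomial.eval b) hq
  simp only [Polynomial.eval_sub, Polynomial.eval_C, Polynomial.eval_mul, Polynomial.eval_X] at h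
  rw [h]
  exact V.le_mul hb (hM b (le_trans (by exact_mod_cast ht) hb)) (by linarith)

variable {F : Type*} [Field F] [Algebra F Ω]

/-- Newton's method: if `f` over a Henselian discretely valued field has a simple root `a` in an
extension that is a limit of elements of the base field, then `f` has a root in the base field. -/
theorem IsHenselianOn.exists_root {V : AddVal Ω} (hhens : V.IsHenselianOn F)
    (hnorm : V.IsNormalizedOn F) (f : Polynomial F) (a : Ω) (hf : Polynomial.aeval a f = 0)
    (hf' : Polynomial.aeval a (Polynomial.derivative f) ≠ 0)
    (ha : ∀ n : ℕ, ∃ b : F, ((n : ℝ) : WithTop ℝ) ≤ V.v (algebraMap F Ω b - a)) :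
    ∃ c : F, Polynomial.eval c f = 0 := by
  obtain ⟨d, hd⟩ := V.exists_coe hf'
  have hbound : ∀ i : ℕ, ∃ M : ℝ, ∀ b : Ω, 0 ≤ V.v (b - a) →
      (M : WithTop ℝ) ≤ V.v (((Polynomial.hasseDeriv i f).map (algebraMap F Ω)).eval b) :=
    fun i => V.exists_le_eval _ a
  choose M hM using hbound
  obtain ⟨k, hk⟩ : ∃ k : ℕ, ∀ i ∈ Finset.range (f.natDegree + 1), d - M i ≤ k := by
    obtain ⟨B, hB⟩ := ((Finset.range (f.natDegree + 1)).image fun i => d - M i).bddAbove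
    obtain ⟨k, hk⟩ := exists_nat_ge B
    exact ⟨k, fun i hi => (hB (by simpa using ⟨i, by simpa using hi, rfl⟩)).trans hk⟩
  obtain ⟨π, hπ⟩ := hnorm.2
  set δ : F := π ^ k with hδ
  have hvδ : V.v (algebraMap F Ω δ) = ((k : ℝ) : WithTop ℝ) := by
    rw [hδ, map_pow, V.v_pow hπ, mul_one]
  obtain ⟨M₀, hM₀⟩ := V.exists_le_eval_sub_eval (f.map (algebraMap F Ω)) a
  obtain ⟨M₁, hM₁⟩ := V.exists_le_eval_sub_eval
    ((Polynomial.derivative f).map (algebraMap F Ω)) a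
  obtain ⟨n, hn⟩ := exists_nat_gt (max (k + d - M₀) (d - M₁))
  have hn₀ : k + d - M₀ < n := (le_max_left _ _).trans_lt hn
  have hn₁ : d - M₁ < n := (le_max_right _ _).trans_lt hn
  obtain ⟨b, hb⟩ := ha n
  have hb0 : 0 ≤ V.v (algebraMap F Ω b - a) :=
    le_trans (by exact_mod_cast Nat.cast_nonneg n) hb
  have h₀ := hM₀ _ n (Nat.cast_nonneg n) hb
  have h₁ := hM₁ _ n (Nat.cast_nonneg n) hb
  simp only [Polynomial.eval_map_algebraMap, Polynomial.aeval_algebraMap_apply_eq_algebraMap_eval]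
    at h₀ h₁ hM
  rw [hf, sub_zero] at h₀
  have hvD : V.v (algebraMap F Ω ((Polynomial.derivative f).eval b)) = (d : WithTop ℝ) := by
    rw [← hd]
    refine V.v_eq_of_lt_sub (lt_of_lt_of_le ?_ h₁)
    rw [hd]
    exact_mod_cast by linarith
  set D : F := (Polynomial.derivative f).eval b with hD
  have ne_zero_of_v {x : F} {r : ℝ} (h : V.v (algebraMap F Ω x) = (r : WithTop ℝ)) : x ≠ 0 := by
    rintro rfl
    rw [map_zero, V.v_zero] at h
    exact WithTop.top_ne_coe h
  have hD0 : D ≠ 0 := ne_zero_of_v hvD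
  have hδ0 : δ ≠ 0 := ne_zero_of_v hvδ
  have hvu : V.v (algebraMap F Ω (δ * D)⁻¹) = ((-(k + d) : ℝ) : WithTop ℝ) := by
    rw [map_inv₀]
    refine V.v_inv ?_
    rw [map_mul, V.v_mul, hvδ, hvD]
    rfl
  set G : Polynomial F := Polynomial.C (δ * D)⁻¹ *
    (Polynomial.taylor b f).comp (Polynomial.C δ * Polynomial.X) with hG
  have hcoeff (i : ℕ) :
      G.coeff i = (δ * D)⁻¹ * ((Polynomial.hasseDeriv i f).eval b * δ ^ i) := by
    rw [hG, Polynomial.coeff_C_mul, Polynomial.comp_C_mul_X_coeff, Polynomial.taylor_coeff]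
  have hG0 : G.coeff 0 = (δ * D)⁻¹ * f.eval b := by simp [hcoeff]
  have hG1 : G.coeff 1 = 1 := by
    rw [hcoeff, Polynomial.hasseDeriv_one, pow_one, ← hD]
    field_simp
  have hvG0 : 0 < V.v (algebraMap F Ω (G.coeff 0)) := by
    refine lt_of_lt_of_le (b := ((-(k + d) + (M₀ + n) : ℝ) : WithTop ℝ)) ?_ ?_
    · exact_mod_cast by linarith
    · rw [hG0, map_mul]
      exact V.le_mul hvu.ge h₀ le_rfl
  have hint (i : ℕ) : 0 ≤ V.v (algebraMap F Ω (G.coeff i)) := by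
    match i with
    | 0 => exact hvG0.le
    | 1 => rw [hG1, map_one, v_one_s6]
    | i + 2 =>
      by_cases hi : f.natDegree < i + 2
      · rw [hcoeff, Polynomial.hasseDeriv_eq_zero_of_lt_natDegree _ _ hi]
        simp [V.v_zero]
      · have hM' := hM (i + 2) _ hb0
        rw [Polynomial.aeval_algebraMap_apply_eq_algebraMap_eval] at hM'
        have hk' := hk (i + 2) (by simp; omega)
        rw [hcoeff, map_mul, map_mul, map_pow]
        refine V.le_mul (c := 0) hvu.ge
          (V.le_mul hM' (V.v_pow hvδ (i + 2)).ge le_rfl) ?_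
        push_cast
        nlinarith [mul_nonneg (Nat.cast_nonneg (α := ℝ) i) (Nat.cast_nonneg (α := ℝ) k)]
  obtain ⟨c, hc, -⟩ := hhens G hint 0 (by simp [V.v_zero])
    (by rwa [← Polynomial.coeff_zero_eq_eval_zero])
    (by
      rw [← Polynomial.coeff_zero_eq_eval_zero, Polynomial.coeff_derivative]
      simp [hG1, v_one_s6])
  refine ⟨δ * c + b, ?_⟩
  rw [hG, Polynomial.eval_mul, Polynomial.eval_C, Polynomial.eval_comp, Polynomial.taylor_eval,
    Polynomial.eval_mul, Polynomial.eval_C, Polynomial.eval_X] at hc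
  exact (mul_eq_zero.mp hc).resolve_left (inv_ne_zero (mul_ne_zero hδ0 hD0))

/-- A Henselian discretely valued field is closed in its separable extensions. -/
theorem IsHenselianOn.mem_range_of_limit [Algebra.IsSeparable F Ω] {V : AddVal Ω}
    (hhens : V.IsHenselianOn F) (hnorm : V.IsNormalizedOn F) (a : Ω)
    (ha : ∀ n : ℕ, ∃ b : F, ((n : ℝ) : WithTop ℝ) ≤ V.v (algebraMap F Ω b - a)) :
    a ∈ (algebraMap F Ω).range := by
  have hsep := Algebra.IsSeparable.isSeparable F a
  obtain ⟨c, hc⟩ := hhens.exists_root hnorm (minpoly F a) a (minpoly.aeval F a)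
    (hsep.aeval_derivative_ne_zero (minpoly.aeval F a)) ha
  exact minpoly.mem_range_of_degree_eq_one F a
    (Polynomial.degree_eq_one_of_irreducible_of_root (minpoly.irreducible hsep.isIntegral) hc)

end AddVal

/-- If `F` is the set of elements of `Ω` lying in `F'`, then every `F`-embedding of a finite
subextension of `Ω` extends to an `F'`-automorphism of `Ω'`. -/
theorem exists_algEquiv_extending_of_inter_eq {F Ω F' Ω' : Type*} [Field F] [Field Ω]
    [Algebra F Ω] [IsGalois F Ω] [Field F'] [Field Ω'] [Algebra F' Ω'] [IsGalois F' Ω']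
    [Algebra F F'] [Algebra F Ω'] [IsScalarTower F F' Ω'] [Algebra Ω Ω'] [IsScalarTower F Ω Ω']
    (hcl : ∀ (a : Ω) (y : F'), algebraMap Ω Ω' a = algebraMap F' Ω' y → a ∈ (algebraMap F Ω).range)
    (E : IntermediateField F Ω) [FiniteDimensional F E] (σ : E →ₐ[F] Ω) :
    ∃ s : Ω' ≃ₐ[F'] Ω', ∀ x : E, s (algebraMap Ω Ω' x) = algebraMap Ω Ω' (σ x) := by
  let N := IntermediateField.normalClosure F E Ω
  have hEN : E ≤ N := E.le_normalClosure
  let res : (Ω' ≃ₐ[F'] Ω') →* (N ≃ₐ[F] N) :=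
    { toFun := fun s => (s.restrictScalars F).restrictNormal N
      map_one' := by
        ext x
        apply (algebraMap Ω Ω').injective
        exact (AlgEquiv.restrictNormal_commutes _ N x)
      map_mul' := fun s t => by
        ext x
        apply (algebraMap Ω Ω').injective
        refine (AlgEquiv.restrictNormal_commutes _ N x).trans ?_
        refine Eq.trans ?_ (AlgEquiv.restrictNormal_commutes (s.restrictScalars F) N _).symm
        exact congrArg s (AlgEquiv.restrictNormal_commutes (t.restrictScalars F) N x).symm }
  have hres (s : Ω' ≃ₐ[F'] Ω') (x : N) :
      algebraMap Ω Ω' (res s x) = s (algebraMap Ω Ω' x) :=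
    AlgEquiv.restrictNormal_commutes (s.restrictScalars F) N x
  have hfix : IntermediateField.fixedField res.range = ⊥ := by
    refine le_bot_iff.mp fun x hx => ?_
    have hx' : algebraMap Ω Ω' x ∈ (⊥ : IntermediateField F' Ω') := by
      rw [InfiniteGalois.mem_bot_iff_fixed]
      intro s
      rw [← hres]
      congr 2
      exact hx ⟨res s, s, rfl⟩
    obtain ⟨y, hy⟩ := IntermediateField.mem_bot.mp hx'
    obtain ⟨b, hb⟩ := hcl x y hy.symm
    exact IntermediateField.mem_bot.mpr ⟨b, Subtype.ext hb⟩
  have htop : res.range = ⊤ := by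
    rw [← IntermediateField.fixingSubgroup_fixedField res.range, hfix,
      IntermediateField.fixingSubgroup_bot]
  let g : Ω →ₐ[F] Ω := σ.liftNormal Ω
  obtain ⟨s, hs⟩ : g.restrictNormal' N ∈ res.range := htop ▸ Subgroup.mem_top _
  refine ⟨s, fun x => ?_⟩
  have h1 := hres s ⟨x, hEN x.2⟩
  rw [hs] at h1
  rw [← h1]
  congr 1
  exact (AlgHom.restrictNormal_commutes g N ⟨x, hEN x.2⟩).trans (σ.liftNormal_commutes Ω x)

/-- The image of a field homomorphism contains all roots of the image of a split polynomial. -/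
theorem Polynomial.Splits.mem_range_of_eval_map_eq_zero {K L : Type*} [Field K] [Field L]
    {p : Polynomial K} (hs : p.Splits) (hp : p ≠ 0) (j : K →+* L) {z : L}
    (hz : (p.map j).eval z = 0) : z ∈ j.range := by
  have hmem : z ∈ (p.map j).roots :=
    (Polynomial.mem_roots (Polynomial.map_ne_zero hp)).mpr hz
  rw [hs.roots_map] at hmem
  obtain ⟨x, -, hx⟩ := Multiset.mem_map.mp hmem
  exact ⟨x, hx⟩

/-- `E` is dense in `Ê`, simultaneously for the topologies induced by two embeddings. -/
theorem exists_approx_of_mem_adjoin {F Ω F' Ω' : Type*} [Field F] [Field Ω] [Algebra F Ω]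
    [Field F'] [Field Ω'] [Algebra F' Ω'] [Algebra.IsAlgebraic F' Ω'] (V' : AddVal Ω')
    (j : Ω →+* Ω') (jF : F →+* F')
    (hcompat : ∀ x : F, j (algebraMap F Ω x) = algebraMap F' Ω' (jF x))
    (hdense : ∀ (y : F') (n : ℕ), ∃ x : F,
      (((n : ℝ)) : WithTop ℝ) ≤ V'.v (algebraMap F' Ω' (y - jF x)))
    (E : IntermediateField F Ω) (σ τ : E →ₐ[F] Ω)
    (σ' τ' : IntermediateField.adjoin F' (j '' (E : Set Ω)) →ₐ[F'] Ω')
    (hσ : ∀ x : E, σ' ⟨j (x : Ω), imgMem j (E : Set Ω) (x : Ω) x.2⟩ = j (σ x))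
    (hτ : ∀ x : E, τ' ⟨j (x : Ω), imgMem j (E : Set Ω) (x : Ω) x.2⟩ = j (τ x))
    (y : IntermediateField.adjoin F' (j '' (E : Set Ω))) (B : ℝ) :
    ∃ x : E, (B : WithTop ℝ) ≤ V'.v ((y : Ω') - j x) ∧
      (B : WithTop ℝ) ≤ V'.v (σ' y - j (σ x)) ∧ (B : WithTop ℝ) ≤ V'.v (τ' y - j (τ x)) := by
  obtain ⟨y, hy⟩ := y
  have hy' : y ∈ Algebra.adjoin F' (j '' (E : Set Ω)) := by
    rwa [← IntermediateField.adjoin_toSubalgebra_of_isAlgebraic fun z _ =>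
      Algebra.IsAlgebraic.isAlgebraic z]
  have hle := IntermediateField.algebra_adjoin_le_adjoin F' (j '' (E : Set Ω))
  suffices H : ∀ B : ℝ, ∃ x : E, (B : WithTop ℝ) ≤ V'.v (y - j x) ∧
      (B : WithTop ℝ) ≤ V'.v (σ' ⟨y, hle hy'⟩ - j (σ x)) ∧
      (B : WithTop ℝ) ≤ V'.v (τ' ⟨y, hle hy'⟩ - j (τ x)) from H B
  clear hy B
  induction hy' using Algebra.adjoin_induction with
  | mem y hy =>
    obtain ⟨x, hx, rfl⟩ := hy
    exact fun B => ⟨⟨x, hx⟩, by simp [V'.v_zero], by rw [← hσ]; simp [V'.v_zero],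
      by rw [← hτ]; simp [V'.v_zero]⟩
  | algebraMap c =>
    intro B
    obtain ⟨n, hn⟩ := exists_nat_ge B
    obtain ⟨b, hb⟩ := hdense c n
    replace hb : (B : WithTop ℝ) ≤ V'.v (algebraMap F' Ω' c - j (algebraMap F Ω b)) := by
      rw [hcompat, ← map_sub]
      exact le_trans (by exact_mod_cast hn) hb
    refine ⟨algebraMap F E b, hb, ?_, ?_⟩
    · rw [AlgHom.commutes]
      convert hb
      exact σ'.commutes c
    · rw [AlgHom.commutes]
      convert hb
      exact τ'.commutes c
  | add y z hy hz ihy ihz =>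
    intro B
    obtain ⟨x, h1, h2, h3⟩ := ihy B
    obtain ⟨w, k1, k2, k3⟩ := ihz B
    have hadd (ρ : IntermediateField.adjoin F' (j '' (E : Set Ω)) →ₐ[F'] Ω') :
        ρ ⟨y + z, hle (add_mem hy hz)⟩ = ρ ⟨y, hle hy⟩ + ρ ⟨z, hle hz⟩ := by
      rw [← map_add]
      rfl
    refine ⟨x + w, ?_, ?_, ?_⟩
    · rw [AddMemClass.coe_add, map_add, add_sub_add_comm]
      exact V'.le_add h1 k1
    · rw [hadd, map_add, map_add, add_sub_add_comm]
      exact V'.le_add h2 k2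
    · rw [hadd, map_add, map_add, add_sub_add_comm]
      exact V'.le_add h3 k3
  | mul y z hy hz ihy ihz =>
    intro B
    have hmul (ρ : IntermediateField.adjoin F' (j '' (E : Set Ω)) →ₐ[F'] Ω') :
        ρ ⟨y * z, hle (mul_mem hy hz)⟩ = ρ ⟨y, hle hy⟩ * ρ ⟨z, hle hz⟩ := by
      rw [← map_mul]
      rfl
    obtain ⟨C₁, hC₁⟩ := V'.exists_le_mul_sub_mul y z B
    obtain ⟨C₂, hC₂⟩ := V'.exists_le_mul_sub_mul (σ' ⟨y, hle hy⟩) (σ' ⟨z, hle hz⟩) B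
    obtain ⟨C₃, hC₃⟩ := V'.exists_le_mul_sub_mul (τ' ⟨y, hle hy⟩) (τ' ⟨z, hle hz⟩) B
    have l1 : (C₁ : WithTop ℝ) ≤ (max C₁ (max C₂ C₃) : ℝ) := by
      exact_mod_cast le_max_left _ _
    have l2 : (C₂ : WithTop ℝ) ≤ (max C₁ (max C₂ C₃) : ℝ) := by
      exact_mod_cast (le_max_left _ _).trans (le_max_right _ _)
    have l3 : (C₃ : WithTop ℝ) ≤ (max C₁ (max C₂ C₃) : ℝ) := by
      exact_mod_cast (le_max_right _ _).trans (le_max_right _ _)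
    obtain ⟨x, h1, h2, h3⟩ := ihy (max C₁ (max C₂ C₃))
    obtain ⟨w, k1, k2, k3⟩ := ihz (max C₁ (max C₂ C₃))
    refine ⟨x * w, ?_, ?_, ?_⟩
    · rw [MulMemClass.coe_mul, map_mul]
      exact hC₁ _ _ (l1.trans h1) (l1.trans k1)
    · rw [hmul, map_mul, map_mul]
      exact hC₂ _ _ (l2.trans h2) (l2.trans k2)
    · rw [hmul, map_mul, map_mul]
      exact hC₃ _ _ (l3.trans h3) (l3.trans k3)

/-- Passage to completion.  Let `F̂` be the completion of `F` (a field
`F'` with compatible normalized valuation, in which `F` is dense, and which is complete),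
`Ω' = (F̂)^sep` a separable closure with a compatible embedding `j : F^sep → (F̂)^sep`, and
`Ê = adjoin F̂ (j(E))` the completion of the finite separable extension `E/F`. The canonical
bijection `Hom_{F-alg}(E, F^sep) → Hom_{F̂-alg}(Ê, (F̂)^sep)` (induced by `E ⊗_F F̂ ≅ Ê`,
i.e. characterized by `σ' (j x) = j (σ x)`) exists and respects the relations `Ξ_r` for
every `r ∈ [-1,∞)`; consequently `φ_{E/F} = φ_{Ê/F̂}` on `[0,∞)`. -/
theorem xiRel_completion_invariance
    {F Ω : Type*} [Field F] [Field Ω] [Algebra F Ω] [IsSepClosure F Ω]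
    (V : AddVal Ω) (hnorm : V.IsNormalizedOn F) (hhens : V.IsHenselianOn F)
    (hperf : V.HasPerfectResidueFieldOn F)
    (E : IntermediateField F Ω) (hfin : FiniteDimensional F ↥E)
    (e : ℕ) (he : V.IsRamIdx E e)
    {F' Ω' : Type*} [Field F'] [Field Ω'] [Algebra F' Ω'] [IsSepClosure F' Ω']
    (V' : AddVal Ω') (hnorm' : V'.IsNormalizedOn F')
    (j : Ω →+* Ω') (jF : F →+* F')
    (hcompat : ∀ x : F, j (algebraMap F Ω x) = algebraMap F' Ω' (jF x))
    (hval : ∀ x : Ω, V'.v (j x) = V.v x)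
    -- `F` is dense in `F'`
    (hdense : ∀ (y : F') (n : ℕ), ∃ x : F,
      (((n : ℝ)) : WithTop ℝ) ≤ V'.v (algebraMap F' Ω' (y - jF x)))
    -- `F'` is complete
    (hcomplete : ∀ a : ℕ → F',
      (∀ n : ℕ, ∃ N : ℕ, ∀ m ≥ N, ∀ m' ≥ N,
        (((n : ℝ)) : WithTop ℝ) ≤ V'.v (algebraMap F' Ω' (a m - a m'))) →
      ∃ y : F', ∀ n : ℕ, ∃ N : ℕ, ∀ m ≥ N,
        (((n : ℝ)) : WithTop ℝ) ≤ V'.v (algebraMap F' Ω' (a m - y)))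
    (he' : V'.IsRamIdx (IntermediateField.adjoin F' (j '' (E : Set Ω))) e) :
    -- the canonical map `σ ↦ σ'` is a well-defined bijection ...
    (∀ σ : ↥E →ₐ[F] Ω,
      ∃! σ' : ↥(IntermediateField.adjoin F' (j '' (E : Set Ω))) →ₐ[F'] Ω',
        ∀ x : ↥E, σ' ⟨j (x : Ω), imgMem j (E : Set Ω) (x : Ω) x.2⟩ = j (σ x)) ∧
    (∀ σ' : ↥(IntermediateField.adjoin F' (j '' (E : Set Ω))) →ₐ[F'] Ω',
      ∃! σ : ↥E →ₐ[F] Ω,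
        ∀ x : ↥E, σ' ⟨j (x : Ω), imgMem j (E : Set Ω) (x : Ω) x.2⟩ = j (σ x)) ∧
    -- ... which respects `Ξ_r` for every `r ∈ [-1,∞)` ...
    (∀ r : ℝ, -1 ≤ r → ∀ (σ τ : ↥E →ₐ[F] Ω)
      (σ' τ' : ↥(IntermediateField.adjoin F' (j '' (E : Set Ω))) →ₐ[F'] Ω'),
      (∀ x : ↥E, σ' ⟨j (x : Ω), imgMem j (E : Set Ω) (x : Ω) x.2⟩ = j (σ x)) →
      (∀ x : ↥E, τ' ⟨j (x : Ω), imgMem j (E : Set Ω) (x : Ω) x.2⟩ = j (τ x)) →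
      (xiRel V E e r σ τ ↔
        xiRel V' (IntermediateField.adjoin F' (j '' (E : Set Ω))) e r σ' τ')) ∧
    (∀ r : ℝ, 0 ≤ r →
      herbrand V E e r =
        herbrand V' (IntermediateField.adjoin F' (j '' (E : Set Ω))) e r) := by
  set S := IntermediateField.adjoin F' (j '' (E : Set Ω)) with hS
  have hext : ∀ σ : E →ₐ[F] Ω, ∃! σ' : S →ₐ[F'] Ω',
      ∀ x : E, σ' ⟨j (x : Ω), imgMem j (E : Set Ω) (x : Ω) x.2⟩ = j (σ x) := by
    intro σ
    refine existsUnique_of_exists_of_unique ?_ fun σ₁ σ₂ h₁ h₂ => ?_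
    · let _ : Algebra F F' := jF.toAlgebra
      let _ : Algebra F Ω' := ((algebraMap F' Ω').comp jF).toAlgebra
      let _ : Algebra Ω Ω' := j.toAlgebra
      have _ : IsScalarTower F F' Ω' := IsScalarTower.of_algebraMap_eq fun _ => rfl
      have _ : IsScalarTower F Ω Ω' := IsScalarTower.of_algebraMap_eq fun x => (hcompat x).symm
      obtain ⟨s, hs⟩ := exists_algEquiv_extending_of_inter_eq (F' := F') (Ω' := Ω')
        (fun a y hay => hhens.mem_range_of_limit hnorm a fun n => by
          obtain ⟨b, hb⟩ := hdense y n
          refine ⟨b, ?_⟩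
          rwa [V.v_sub_comm, ← hval, map_sub, hcompat, show j a = algebraMap F' Ω' y from hay,
            ← map_sub]) E σ
      exact ⟨s.toAlgHom.comp S.val, hs⟩
    · refine IntermediateField.algHom_ext_of_eq_adjoin F' hS fun x hx => ?_
      obtain ⟨a, ha, rfl⟩ := hx
      exact (h₁ ⟨a, ha⟩).trans (h₂ ⟨a, ha⟩).symm
  have hres : ∀ σ' : S →ₐ[F'] Ω', ∃! σ : E →ₐ[F] Ω,
      ∀ x : E, σ' ⟨j (x : Ω), imgMem j (E : Set Ω) (x : Ω) x.2⟩ = j (σ x) := by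
    intro σ'
    refine existsUnique_of_exists_of_unique ?_ fun σ₁ σ₂ h₁ h₂ =>
      AlgHom.ext fun x => j.injective ((h₁ x).symm.trans (h₂ x))
    let jE : E →+* S := (j.comp (algebraMap E Ω)).codRestrict S.toSubring
      fun x => imgMem j (E : Set Ω) (x : Ω) x.2
    let ρ : E →+* Ω' := (σ' : S →+* Ω').comp jE
    have hρ (c : F) : ρ (algebraMap F E c) = j (algebraMap F Ω c) := by
      rw [hcompat, ← σ'.commutes]
      exact congrArg σ' (Subtype.ext (hcompat c))
    have hmem (x : E) : ρ x ∈ j.range := by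
      refine (Normal.splits (F := F) (K := Ω) inferInstance (x : Ω)).mem_range_of_eval_map_eq_zero
        (Polynomial.map_ne_zero (minpoly.ne_zero (Normal.isIntegral inferInstance (x : Ω)))) j ?_
      rw [Polynomial.map_map, show j.comp (algebraMap F Ω) = ρ.comp (algebraMap F E) from
          RingHom.ext fun c => (hρ c).symm, Polynomial.eval_map, ← Polynomial.hom_eval₂,
        ← IntermediateField.minpoly_eq, ← Polynomial.aeval_def, minpoly.aeval, map_zero]
    choose f hf using hmem
    let σ : E →ₐ[F] Ω :=
      { toFun := f
        map_one' := j.injective (by simp only [hf, map_one])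
        map_mul' := fun x y => j.injective (by simp only [hf, map_mul])
        map_zero' := j.injective (by simp only [hf, map_zero])
        map_add' := fun x y => j.injective (by simp only [hf, map_add])
        commutes' := fun c => j.injective (by rw [hf, hρ]) }
    exact ⟨σ, fun x => (hf x).symm⟩
  have hxi : ∀ r : ℝ, -1 ≤ r → ∀ (σ τ : E →ₐ[F] Ω) (σ' τ' : S →ₐ[F'] Ω'),
      (∀ x : E, σ' ⟨j (x : Ω), imgMem j (E : Set Ω) (x : Ω) x.2⟩ = j (σ x)) →
      (∀ x : E, τ' ⟨j (x : Ω), imgMem j (E : Set Ω) (x : Ω) x.2⟩ = j (τ x)) →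
      (xiRel V E e r σ τ ↔ xiRel V' S e r σ' τ') := by
    intro r _ σ τ σ' τ' hσ hτ
    constructor
    · intro h y hy
      obtain ⟨x, hx, hxσ, hxτ⟩ := exists_approx_of_mem_adjoin V' j jF hcompat hdense E σ τ σ' τ'
        hσ hτ y (max 0 ((r + 1) / e))
      have h0 : (0 : WithTop ℝ) ≤ (max 0 ((r + 1) / e) : ℝ) := by
        exact_mod_cast le_max_left _ _
      have hr : (((r + 1) / e : ℝ) : WithTop ℝ) ≤ (max 0 ((r + 1) / e) : ℝ) := by
        exact_mod_cast le_max_right _ _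
      have hx0 : 0 ≤ V.v (x : Ω) := by
        have := V'.le_sub hy (h0.trans hx)
        rwa [sub_sub_cancel, hval] at this
      have hxr := h x hx0
      rw [← hval, map_sub] at hxr
      have := V'.le_sub (V'.le_add (hr.trans hxσ) hxr) (hr.trans hxτ)
      rwa [sub_add_sub_cancel, sub_sub_sub_cancel_right] at this
    · intro h x hx
      have := h ⟨j x, imgMem j (E : Set Ω) (x : Ω) x.2⟩ (by rwa [hval])
      rwa [hσ, hτ, ← map_sub, hval] at this
  have hg : ∀ t : ℝ, 0 ≤ t → gfun V E e t = gfun V' S e t := by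
    intro t ht
    choose f hf hfu using hext
    refine Nat.card_congr (Equiv.ofBijective
      (fun σ => ⟨f σ.1, (hxi t (by linarith) _ _ _ _ (hf σ.1) fun _ => rfl).mp σ.2⟩)
      ⟨fun σ₁ σ₂ h => ?_, fun σ' => ?_⟩)
    · have h' : f σ₁.1 = f σ₂.1 := congrArg Subtype.val h
      exact Subtype.ext ((hres (f σ₁.1)).unique (hf _) (h' ▸ hf _))
    · obtain ⟨σ, hσ, -⟩ := hres σ'.1
      refine ⟨⟨σ, (hxi t (by linarith) _ _ _ _ hσ fun _ => rfl).mpr σ'.2⟩, ?_⟩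
      exact Subtype.ext (hfu σ σ'.1 hσ).symm
  refine ⟨hext, hres, hxi, fun r hr => ?_⟩
  refine intervalIntegral.integral_congr fun t ht => ?_
  rw [Set.uIcc_of_le hr] at ht
  simp only [hg t ht.1, hg 0 le_rfl]
  rfl
end
end
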